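/- arXiv:2012.03440 — 9 statements merged into one kernel-verified Lean document; each statement's English description precedes it below -/
import Mathlib

section
/- For every q ∈ {0,…,Q}, the half-open intervals exhaust the full channel range: ⋃_{k=1}^{M} ⋃_{s=0}^{S_max} (h_{k,s,q}^min, h_{k,s,q}^max] = (h_min, h_max]. -/
open MeasureTheory

/-- Consecutive half-open intervals between the terms of a finite nondecreasing sequence
cover the interval between its first and last terms. -/
theorem biUnion_range_Ioc_succ {α : Type*} [LinearOrder α] (c : ℕ → α) (n : ℕ)
    (hc : ∀ i < n, c i ≤ c (i + 1)) :
    ⋃ i ∈ Finset.range n, Set.Ioc (c i) (c (i + 1)) = Set.Ioc (c 0) (c n) := by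
  suffices h : c 0 ≤ c n ∧
      ⋃ i ∈ Finset.range n, Set.Ioc (c i) (c (i + 1)) = Set.Ioc (c 0) (c n) from h.2
  induction n with
  | zero => simp
  | succ n ih =>
    obtain ⟨hle, hU⟩ := ih fun i hi => hc i (hi.trans n.lt_succ_self)
    have hn := hc n n.lt_succ_self
    refine ⟨hle.trans hn, ?_⟩
    rw [Finset.range_add_one, Finset.set_biUnion_insert, hU, Set.union_comm,
      Set.Ioc_union_Ioc_eq_Ioc hle hn]

theorem stmt_2
    (hmin hmax : ℝ) (Q Smax M : ℕ)
    (h0 : 0 < hmin) (h1 : hmin < hmax) (hM : 0 < M)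
    (hkmin hkmax : ℕ → ℝ)
    (hhkmin : ∀ k : ℕ, hkmin k = hmin + ((k : ℝ) - 1) * (hmax - hmin) / M)
    (hhkmax : ∀ k : ℕ, hkmax k = hmin + (k : ℝ) * (hmax - hmin) / M)
    (g : ℕ → ℕ → ℝ → ℝ)
    (hg_nonneg : ∀ q, q ≤ Q → ∀ s, s ≤ Smax → ∀ x : ℝ, 0 ≤ g q s x)
    (hg_meas : ∀ q, q ≤ Q → ∀ s, s ≤ Smax → Measurable (g q s))
    (hg_int : ∀ q, q ≤ Q → ∀ s, s ≤ Smax → IntegrableOn (g q s) (Set.Ioc hmin hmax))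
    (U : ℕ → ℝ → ℝ)
    (hU : ∀ q, q ≤ Q → ∀ x ∈ Set.Icc hmin hmax,
        U q x = ∫ t in Set.Ioc hmin x, ∑ s ∈ Finset.range (Smax + 1), g q s t)
    (V : ℕ → ℝ → ℝ)
    (hV_mono : ∀ q, q ≤ Q → Monotone (V q))
    (hVU : ∀ q, q ≤ Q → ∀ x ∈ Set.Icc hmin hmax, V q (U q x) = x)
    (hUV : ∀ q, q ≤ Q → ∀ t ∈ Set.Icc 0 (U q hmax), U q (V q t) = t)
    (hVmem : ∀ q, q ≤ Q → ∀ t ∈ Set.Icc 0 (U q hmax), V q t ∈ Set.Icc hmin hmax)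
    (Hmax Hmin : ℕ → ℕ → ℕ → ℝ)
    (hHmax : ∀ k s q, Hmax k s q = V q (U q (hkmin k) +
        ∫ t in Set.Ioc (hkmin k) (hkmax k), ∑ x ∈ Finset.range (s + 1), g q x t))
    (hHmin0 : ∀ k q, Hmin k 0 q = hkmin k)
    (hHminS : ∀ k s q, Hmin k (s + 1) q = Hmax k s q)
 :
    ∀ q, q ≤ Q →
      (⋃ k ∈ Finset.Icc 1 M, ⋃ s ∈ Finset.range (Smax + 1),
        Set.Ioc (Hmin k s q) (Hmax k s q)) = Set.Ioc hmin hmax := by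
  intro q hq
  have hMR : (0 : ℝ) < M := by exact_mod_cast hM
  have hk_succ : ∀ j : ℕ, hkmin (j + 1) = hkmax j := fun j => by
    rw [hhkmin, hhkmax]; push_cast; ring
  have hk_mono : Monotone hkmax := fun i j hij => by
    rw [hhkmax, hhkmax]
    have : (i : ℝ) ≤ j := by exact_mod_cast hij
    have := sub_pos.2 h1
    gcongr
  have hk_zero : hkmax 0 = hmin := by simp [hhkmax]
  have hk_M : hkmax M = hmax := by rw [hhkmax]; field_simp; ring
  have hk_mem : ∀ j ≤ M, hkmax j ∈ Set.Icc hmin hmax := fun j hj =>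
    ⟨hk_zero ▸ hk_mono j.zero_le, hk_M ▸ hk_mono hj⟩
  have h_int : ∀ s ≤ Smax + 1, IntegrableOn (fun t => ∑ x ∈ Finset.range s, g q x t)
      (Set.Ioc hmin hmax) := fun s hs =>
    integrable_finsetSum _ fun x hx =>
      hg_int q hq x (by have := Finset.mem_range.1 hx; omega)
  have h_cell : ∀ j < M, ⋃ s ∈ Finset.range (Smax + 1),
      Set.Ioc (Hmin (j + 1) s q) (Hmax (j + 1) s q) = Set.Ioc (hkmax j) (hkmax (j + 1)) := by
    intro j hj
    have ha := hk_mem j hj.le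
    have hb := hk_mem (j + 1) hj
    have hab := hk_mono j.le_succ
    have hc : ∀ s, Hmin (j + 1) s q = V q (U q (hkmax j) +
        ∫ t in Set.Ioc (hkmax j) (hkmax (j + 1)), ∑ x ∈ Finset.range s, g q x t) := by
      rintro (_ | s)
      · simp [hHmin0, hk_succ, hVU q hq _ ha]
      · rw [hHminS, hHmax, hk_succ]
    have h_last : Hmin (j + 1) (Smax + 1) q = hkmax (j + 1) := by
      rw [hc, hU q hq _ ha, ← setIntegral_union (Set.Ioc_disjoint_Ioc_of_le le_rfl)
        measurableSet_Ioc ((h_int _ le_rfl).mono_set (Set.Ioc_subset_Ioc_right ha.2))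
        ((h_int _ le_rfl).mono_set (Set.Ioc_subset_Ioc ha.1 hb.2)),
        Set.Ioc_union_Ioc_eq_Ioc ha.1 hab, ← hU q hq _ hb, hVU q hq _ hb]
    have h_mono : ∀ s < Smax + 1, Hmin (j + 1) s q ≤ Hmin (j + 1) (s + 1) q := by
      intro s hs
      rw [hc, hc]
      refine hV_mono q hq (add_le_add_right (integral_mono
        ((h_int _ hs.le).mono_set (Set.Ioc_subset_Ioc ha.1 hb.2))
        ((h_int _ hs).mono_set (Set.Ioc_subset_Ioc ha.1 hb.2)) fun t => ?_) _)
      simpa [Finset.sum_range_succ] using hg_nonneg q hq s (Nat.lt_succ_iff.1 hs) t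
    have := biUnion_range_Ioc_succ (fun s => Hmin (j + 1) s q) (Smax + 1) h_mono
    rw [h_last, hHmin0, hk_succ] at this
    simpa only [hHminS] using this
  calc _ = ⋃ j ∈ Finset.range M, ⋃ s ∈ Finset.range (Smax + 1),
        Set.Ioc (Hmin (j + 1) s q) (Hmax (j + 1) s q) := by
        have h_image : Finset.Icc 1 M = (Finset.range M).image (· + 1) := by
          ext k
          simp only [Finset.mem_Icc, Finset.mem_image, Finset.mem_range]
          exact ⟨fun hk => ⟨k - 1, by omega, by omega⟩, by rintro ⟨j, hj, rfl⟩; omega⟩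
        rw [h_image, Finset.set_biUnion_finset_image]
    _ = ⋃ j ∈ Finset.range M, Set.Ioc (hkmax j) (hkmax (j + 1)) :=
        Set.iUnion₂_congr fun j hj => h_cell j (Finset.mem_range.1 hj)
    _ = Set.Ioc hmin hmax := by
        rw [biUnion_range_Ioc_succ hkmax M fun i _ => hk_mono i.le_succ, hk_zero, hk_M]
end

section
/- (Lemma 6) For every q ∈ {0,…,Q} and every h ∈ (h_min, h_max], there is exactly one pair (k,s) with k ∈ {1,…,M} and s ∈ {0,…,S_max} such that h ∈ (h_{k,s,q}^min, h_{k,s,q}^max]; consequently, for each q and h there is at most one s ∈ {0,…,S_max} with y_M(q,s,h) > 0. -/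
open MeasureTheory

/-- A monotone finite sequence `a 0 ≤ ⋯ ≤ a n` partitions `(a 0, a n]` into the intervals
`(a i, a (i + 1)]`. -/
theorem existsUnique_mem_Ioc_of_monotoneOn {α : Type*} [LinearOrder α] {a : ℕ → α} {n : ℕ}
    (ha : MonotoneOn a (Set.Iic n)) {x : α} (hx : x ∈ Set.Ioc (a 0) (a n)) :
    ∃! i, i < n ∧ x ∈ Set.Ioc (a i) (a (i + 1)) := by
  classical
  have disjoint : ∀ i j, i < j → j < n → x ≤ a (i + 1) → ¬ a j < x := fun i j hij hj hi hlt =>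
    (hi.trans (ha (Set.mem_Iic.2 (by omega)) (Set.mem_Iic.2 hj.le) hij)).not_gt hlt
  have hex : ∃ i, x ≤ a i := ⟨n, hx.2⟩
  have hpos : Nat.find hex ≠ 0 := fun h => (h ▸ Nat.find_spec hex).not_gt hx.1
  obtain ⟨i, hi⟩ := Nat.exists_eq_succ_of_ne_zero hpos
  have hle : Nat.find hex ≤ n := Nat.find_min' hex hx.2
  refine ⟨i, ⟨by omega, not_le.1 (Nat.find_min hex (by omega)), ?_⟩, ?_⟩
  · simpa [hi] using Nat.find_spec hex
  · rintro j ⟨hj, hjx⟩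
    have hix : x ≤ a (i + 1) := by simpa [hi] using Nat.find_spec hex
    rcases lt_trichotomy j i with h | h | h
    · exact absurd (not_le.1 (Nat.find_min hex (by omega))) (disjoint j i h (by omega) hjx.2)
    · exact h
    · exact absurd hjx.1 (disjoint i j h hj hix)

theorem stmt_4
    (hmin hmax : ℝ) (Q Smax M : ℕ)
    (h0 : 0 < hmin) (h1 : hmin < hmax) (hM : 0 < M)
    (hkmin hkmax : ℕ → ℝ)
    (hhkmin : ∀ k : ℕ, hkmin k = hmin + ((k : ℝ) - 1) * (hmax - hmin) / M)
    (hhkmax : ∀ k : ℕ, hkmax k = hmin + (k : ℝ) * (hmax - hmin) / M)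
    (g : ℕ → ℕ → ℝ → ℝ)
    (hg_nonneg : ∀ q, q ≤ Q → ∀ s, s ≤ Smax → ∀ x : ℝ, 0 ≤ g q s x)
    (hg_meas : ∀ q, q ≤ Q → ∀ s, s ≤ Smax → Measurable (g q s))
    (hg_int : ∀ q, q ≤ Q → ∀ s, s ≤ Smax → IntegrableOn (g q s) (Set.Ioc hmin hmax))
    (U : ℕ → ℝ → ℝ)
    (hU : ∀ q, q ≤ Q → ∀ x ∈ Set.Icc hmin hmax,
        U q x = ∫ t in Set.Ioc hmin x, ∑ s ∈ Finset.range (Smax + 1), g q s t)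
    (V : ℕ → ℝ → ℝ)
    (hV_mono : ∀ q, q ≤ Q → Monotone (V q))
    (hVU : ∀ q, q ≤ Q → ∀ x ∈ Set.Icc hmin hmax, V q (U q x) = x)
    (hUV : ∀ q, q ≤ Q → ∀ t ∈ Set.Icc 0 (U q hmax), U q (V q t) = t)
    (hVmem : ∀ q, q ≤ Q → ∀ t ∈ Set.Icc 0 (U q hmax), V q t ∈ Set.Icc hmin hmax)
    (Hmax Hmin : ℕ → ℕ → ℕ → ℝ)
    (hHmax : ∀ k s q, Hmax k s q = V q (U q (hkmin k) +
        ∫ t in Set.Ioc (hkmin k) (hkmax k), ∑ x ∈ Finset.range (s + 1), g q x t))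
    (hHmin0 : ∀ k q, Hmin k 0 q = hkmin k)
    (hHminS : ∀ k s q, Hmin k (s + 1) q = Hmax k s q)
    (y : ℕ → ℕ → ℝ → ℝ)
    (hy : ∀ q s (x : ℝ), y q s x = ∑ k ∈ Finset.Icc 1 M,
        (∑ j ∈ Finset.range (Smax + 1), g q j x) *
          (if x ∈ Set.Ioc (Hmin k s q) (Hmax k s q) then (1 : ℝ) else 0))
 :
    ∀ q, q ≤ Q → ∀ x ∈ Set.Ioc hmin hmax,
      (∃! p : ℕ × ℕ, 1 ≤ p.1 ∧ p.1 ≤ M ∧ p.2 ≤ Smax ∧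
        x ∈ Set.Ioc (Hmin p.1 p.2 q) (Hmax p.1 p.2 q)) ∧
      (∀ s₁ s₂ : ℕ, s₁ ≤ Smax → s₂ ≤ Smax →
        0 < y q s₁ x → 0 < y q s₂ x → s₁ = s₂) := by
  intro q hq x hx
  have hMpos : (0 : ℝ) < M := by exact_mod_cast hM
  have hstep : 0 < hmax - hmin := sub_pos.2 h1
  have hkmax_mono : Monotone hkmax := fun i j hij => by
    rw [hhkmax, hhkmax]
    gcongr
  have hkmax_zero : hkmax 0 = hmin := by simp [hhkmax]
  have hkmax_M : hkmax M = hmax := by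
    rw [hhkmax]
    field_simp
    ring
  have hkmin_succ : ∀ k, hkmin (k + 1) = hkmax k := fun k => by
    rw [hhkmin, hhkmax]
    push_cast
    ring
  have hmem : ∀ k, k ≤ M → hkmax k ∈ Set.Icc hmin hmax := fun k hk =>
    ⟨hkmax_zero ▸ hkmax_mono k.zero_le, hkmax_M ▸ hkmax_mono hk⟩
  have hint : ∀ n, n ≤ Smax + 1 → IntegrableOn (fun t => ∑ j ∈ Finset.range n, g q j t)
      (Set.Ioc hmin hmax) := fun n hn =>
    integrable_finsetSum _ fun j hj => hg_int q hq j (by have := Finset.mem_range.1 hj; omega)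
  have hHmin_eq : ∀ k, k < M → ∀ s, Hmin (k + 1) s q = V q (U q (hkmax k) +
      ∫ t in Set.Ioc (hkmax k) (hkmax (k + 1)), ∑ j ∈ Finset.range s, g q j t) := by
    intro k hk s
    cases s with
    | zero => simp [hHmin0, hkmin_succ, hVU q hq _ (hmem k hk.le)]
    | succ s => rw [hHminS, hHmax, hkmin_succ]
  have hHmin_mono : ∀ k, k < M →
      MonotoneOn (fun s => Hmin (k + 1) s q) (Set.Iic (Smax + 1)) := by
    intro k hk i hi j hj hij
    have hsub : Set.Ioc (hkmax k) (hkmax (k + 1)) ⊆ Set.Ioc hmin hmax :=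
      Set.Ioc_subset_Ioc (hmem k hk.le).1 (hmem (k + 1) hk).2
    simp only [hHmin_eq k hk]
    refine hV_mono q hq (add_le_add le_rfl ?_)
    refine integral_mono ((hint i hi).mono_set hsub) ((hint j hj).mono_set hsub) fun t => ?_
    refine Finset.sum_le_sum_of_subset_of_nonneg (Finset.range_mono hij) fun l hl _ => ?_
    have hlt := Finset.mem_range.1 hl
    have hjS := Set.mem_Iic.1 hj
    exact hg_nonneg q hq l (by omega) t
  have hHmin_last : ∀ k, k < M → Hmin (k + 1) (Smax + 1) q = hkmax (k + 1) := by
    intro k hk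
    have hle := hkmax_mono k.le_succ
    rw [hHmin_eq k hk,
      hU q hq _ (hmem k hk.le), ← setIntegral_union (Set.Ioc_disjoint_Ioc_of_le le_rfl)
        measurableSet_Ioc ((hint _ le_rfl).mono_set (Set.Ioc_subset_Ioc_right (hmem k hk.le).2))
        ((hint _ le_rfl).mono_set
          (Set.Ioc_subset_Ioc (hmem k hk.le).1 (hmem (k + 1) hk).2)),
      Set.Ioc_union_Ioc_eq_Ioc (hmem k hk.le).1 hle, ← hU q hq _ (hmem (k + 1) hk),
      hVU q hq _ (hmem (k + 1) hk)]
  have hHmin_zero : ∀ k, Hmin (k + 1) 0 q = hkmax k := fun k => by rw [hHmin0, hkmin_succ]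
  have hunique : ∃! p : ℕ × ℕ, 1 ≤ p.1 ∧ p.1 ≤ M ∧ p.2 ≤ Smax ∧
      x ∈ Set.Ioc (Hmin p.1 p.2 q) (Hmax p.1 p.2 q) := by
    obtain ⟨k, ⟨hk, hxk⟩, hk_unique⟩ :=
      existsUnique_mem_Ioc_of_monotoneOn (n := M) (hkmax_mono.monotoneOn _)
        (by rwa [hkmax_zero, hkmax_M] : x ∈ Set.Ioc (hkmax 0) (hkmax M))
    obtain ⟨s, ⟨hs, hxs⟩, hs_unique⟩ :=
      existsUnique_mem_Ioc_of_monotoneOn (hHmin_mono k hk) (x := x)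
        (by simpa only [hHmin_zero, hHmin_last k hk] using hxk)
    refine ⟨(k + 1, s), ⟨by omega, hk, by omega, by simpa only [hHminS] using hxs⟩, ?_⟩
    rintro ⟨k', s'⟩ ⟨hk'1, hk'M, hs', hx'⟩
    obtain ⟨k', rfl⟩ := Nat.exists_eq_add_of_le' hk'1
    dsimp only at hk'M hs' hx'
    rw [← hHminS] at hx'
    have hx'k : x ∈ Set.Ioc (hkmax k') (hkmax (k' + 1)) := by
      rw [← hHmin_zero, ← hHmin_last k' hk'M]
      have hmono := hHmin_mono k' hk'M
      exact Set.Ioc_subset_Ioc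
        (hmono (Set.mem_Iic.2 (by omega)) (Set.mem_Iic.2 (by omega)) s'.zero_le)
        (hmono (Set.mem_Iic.2 (by omega)) (Set.mem_Iic.2 le_rfl) (by omega)) hx'
    obtain rfl : k' = k := hk_unique k' ⟨hk'M, hx'k⟩
    rw [hs_unique s' ⟨by omega, hx'⟩]
  refine ⟨hunique, fun s₁ s₂ hs₁ hs₂ hy₁ hy₂ => ?_⟩
  have hsupport : ∀ s, 0 < y q s x →
      ∃ k, 1 ≤ k ∧ k ≤ M ∧ x ∈ Set.Ioc (Hmin k s q) (Hmax k s q) := by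
    intro s hs
    rw [hy] at hs
    obtain ⟨k, hk, hne⟩ := Finset.exists_ne_zero_of_sum_ne_zero hs.ne'
    have hk' := Finset.mem_Icc.1 hk
    exact ⟨k, hk'.1, hk'.2, by_contra fun hnot => hne (by rw [if_neg hnot, mul_zero])⟩
  obtain ⟨k₁, hk₁, hk₁M, hx₁⟩ := hsupport s₁ hy₁
  obtain ⟨k₂, hk₂, hk₂M, hx₂⟩ := hsupport s₂ hy₂
  exact congrArg Prod.snd
    (hunique.unique (y₁ := (k₁, s₁)) (y₂ := (k₂, s₂))
      ⟨hk₁, hk₁M, hs₁, hx₁⟩ ⟨hk₂, hk₂M, hs₂, hx₂⟩)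
end

section
/- (Lemma 1) For every q ∈ {0,…,Q} and every h ∈ (h_min, h_max], Σ_{s=0}^{S_max} y_M(q,s,h) = Σ_{x=0}^{S_max} g(q,x,h); consequently, if f_H : ℝ → ℝ satisfies Σ_{q=0}^{Q} Σ_{s=0}^{S_max} g(q,s,h) = f_H(h) for all h ∈ (h_min, h_max], then Σ_{q=0}^{Q} Σ_{s=0}^{S_max} y_M(q,s,h) = f_H(h) for all h ∈ (h_min, h_max]. -/
open MeasureTheory

/-- Consecutive half-open intervals of a sequence that increases up to `N` partition the
interval between its endpoints. -/
theorem sum_range_indicator_Ioc (a : ℕ → ℝ) (x : ℝ) (N : ℕ) (ha : ∀ n < N, a n ≤ a (n + 1)) :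
    a 0 ≤ a N ∧
      ∑ n ∈ Finset.range N, (if x ∈ Set.Ioc (a n) (a (n + 1)) then (1 : ℝ) else 0) =
        if x ∈ Set.Ioc (a 0) (a N) then 1 else 0 := by
  induction N with
  | zero => simp
  | succ N ih =>
    obtain ⟨h1, h2⟩ := ih fun n hn => ha n (by omega)
    have h3 := ha N (by omega)
    refine ⟨h1.trans h3, ?_⟩
    rw [Finset.sum_range_succ, h2]
    simp only [Set.mem_Ioc]
    grind

theorem stmt_5
    (hmin hmax : ℝ) (Q Smax M : ℕ)
    (h0 : 0 < hmin) (h1 : hmin < hmax) (hM : 0 < M)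
    (hkmin hkmax : ℕ → ℝ)
    (hhkmin : ∀ k : ℕ, hkmin k = hmin + ((k : ℝ) - 1) * (hmax - hmin) / M)
    (hhkmax : ∀ k : ℕ, hkmax k = hmin + (k : ℝ) * (hmax - hmin) / M)
    (g : ℕ → ℕ → ℝ → ℝ)
    (hg_nonneg : ∀ q, q ≤ Q → ∀ s, s ≤ Smax → ∀ x : ℝ, 0 ≤ g q s x)
    (hg_meas : ∀ q, q ≤ Q → ∀ s, s ≤ Smax → Measurable (g q s))
    (hg_int : ∀ q, q ≤ Q → ∀ s, s ≤ Smax → IntegrableOn (g q s) (Set.Ioc hmin hmax))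
    (U : ℕ → ℝ → ℝ)
    (hU : ∀ q, q ≤ Q → ∀ x ∈ Set.Icc hmin hmax,
        U q x = ∫ t in Set.Ioc hmin x, ∑ s ∈ Finset.range (Smax + 1), g q s t)
    (V : ℕ → ℝ → ℝ)
    (hV_mono : ∀ q, q ≤ Q → Monotone (V q))
    (hVU : ∀ q, q ≤ Q → ∀ x ∈ Set.Icc hmin hmax, V q (U q x) = x)
    (hUV : ∀ q, q ≤ Q → ∀ t ∈ Set.Icc 0 (U q hmax), U q (V q t) = t)
    (hVmem : ∀ q, q ≤ Q → ∀ t ∈ Set.Icc 0 (U q hmax), V q t ∈ Set.Icc hmin hmax)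
    (Hmax Hmin : ℕ → ℕ → ℕ → ℝ)
    (hHmax : ∀ k s q, Hmax k s q = V q (U q (hkmin k) +
        ∫ t in Set.Ioc (hkmin k) (hkmax k), ∑ x ∈ Finset.range (s + 1), g q x t))
    (hHmin0 : ∀ k q, Hmin k 0 q = hkmin k)
    (hHminS : ∀ k s q, Hmin k (s + 1) q = Hmax k s q)
    (y : ℕ → ℕ → ℝ → ℝ)
    (hy : ∀ q s (x : ℝ), y q s x = ∑ k ∈ Finset.Icc 1 M,
        (∑ j ∈ Finset.range (Smax + 1), g q j x) *
          (if x ∈ Set.Ioc (Hmin k s q) (Hmax k s q) then (1 : ℝ) else 0))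
 :
    (∀ q, q ≤ Q → ∀ x ∈ Set.Ioc hmin hmax,
      ∑ s ∈ Finset.range (Smax + 1), y q s x =
        ∑ j ∈ Finset.range (Smax + 1), g q j x) ∧
    (∀ fH : ℝ → ℝ,
      (∀ x ∈ Set.Ioc hmin hmax,
        ∑ q ∈ Finset.range (Q + 1), ∑ s ∈ Finset.range (Smax + 1), g q s x = fH x) →
      (∀ x ∈ Set.Ioc hmin hmax,
        ∑ q ∈ Finset.range (Q + 1), ∑ s ∈ Finset.range (Smax + 1), y q s x = fH x)) := by
  have hMpos : (0 : ℝ) < M := by exact_mod_cast hM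
  have hstep : 0 ≤ (hmax - hmin) / M := div_nonneg (by linarith) hMpos.le
  have hmax_eq : hkmax M = hmax := by
    rw [hhkmax]
    field_simp
    ring
  have hmin_succ : ∀ k, hkmin (k + 1) = hkmax k := by
    intro k
    rw [hhkmin, hhkmax]
    push_cast
    ring
  have hkmax_zero : hkmax 0 = hmin := by simp [hhkmax]
  have hkmax_mono : Monotone hkmax := by
    refine monotone_nat_of_le_succ fun k => ?_
    rw [hhkmax, hhkmax, mul_div_assoc, mul_div_assoc]
    push_cast
    linarith
  have hsum : ∀ q, q ≤ Q → ∀ x ∈ Set.Ioc hmin hmax,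
      ∑ s ∈ Finset.range (Smax + 1), y q s x = ∑ j ∈ Finset.range (Smax + 1), g q j x := by
    intro q hq x hx
    have hblock : ∀ k < M, ∑ s ∈ Finset.range (Smax + 1),
        (if x ∈ Set.Ioc (Hmin (k + 1) s q) (Hmax (k + 1) s q) then (1 : ℝ) else 0) =
          if x ∈ Set.Ioc (hkmax k) (hkmax (k + 1)) then 1 else 0 := by
      intro k hk
      have hlo : hmin ≤ hkmax k := hkmax_zero ▸ hkmax_mono (Nat.zero_le k)
      have hmid : hkmax k ≤ hkmax (k + 1) := hkmax_mono (Nat.le_succ k)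
      have hhi : hkmax (k + 1) ≤ hmax := hmax_eq ▸ hkmax_mono hk
      have hint : ∀ s ≤ Smax, ∀ a b, hmin ≤ a → b ≤ hmax →
          IntegrableOn (fun t => ∑ j ∈ Finset.range (s + 1), g q j t) (Set.Ioc a b) := by
        intro s hs a b ha hb
        refine integrable_finsetSum _ fun j hj => ?_
        exact (hg_int q hq j (by grind)).mono_set (Set.Ioc_subset_Ioc ha hb)
      have htop : Hmax (k + 1) Smax q = hkmax (k + 1) := by
        rw [hHmax, hmin_succ, hU q hq _ ⟨hlo, hmid.trans hhi⟩,
          ← setIntegral_union (Set.Ioc_disjoint_Ioc_of_le le_rfl) measurableSet_Ioc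
            (hint Smax le_rfl _ _ le_rfl (hmid.trans hhi)) (hint Smax le_rfl _ _ hlo hhi),
          Set.Ioc_union_Ioc_eq_Ioc hlo hmid, ← hU q hq _ ⟨hlo.trans hmid, hhi⟩,
          hVU q hq _ ⟨hlo.trans hmid, hhi⟩]
      have hmono : ∀ s < Smax + 1, Hmin (k + 1) s q ≤ Hmin (k + 1) (s + 1) q := by
        intro s hs
        rw [hHminS, hHmax, hmin_succ]
        cases s with
        | zero =>
          rw [hHmin0, hmin_succ]
          conv_lhs => rw [← hVU q hq (hkmax k) ⟨hlo, hmid.trans hhi⟩]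
          refine hV_mono q hq (le_add_of_nonneg_right ?_)
          exact integral_nonneg fun t =>
            Finset.sum_nonneg fun j hj => hg_nonneg q hq j (by grind) t
        | succ s =>
          rw [hHminS, hHmax, hmin_succ]
          refine hV_mono q hq (add_le_add_right ?_ _)
          refine integral_mono (hint s (by omega) _ _ hlo hhi)
            (hint (s + 1) (by omega) _ _ hlo hhi) fun t => ?_
          simp only [Finset.sum_range_succ _ (s + 1)]
          exact le_add_of_nonneg_right (hg_nonneg q hq (s + 1) (by omega) t)
      have htel := (sum_range_indicator_Ioc (fun s => Hmin (k + 1) s q) x (Smax + 1) hmono).2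
      simpa only [hHminS, hHmin0, htop, hmin_succ] using htel
    have hcover := (sum_range_indicator_Ioc hkmax x M fun n _ => hkmax_mono (Nat.le_succ n)).2
    rw [hkmax_zero, hmax_eq, if_pos hx] at hcover
    simp only [hy]
    rw [Finset.sum_comm]
    simp only [← Finset.mul_sum]
    rw [← Finset.Ico_add_one_right_eq_Icc, Finset.sum_Ico_eq_sum_range, Nat.add_sub_cancel]
    simp only [Nat.add_comm 1]
    rw [Finset.sum_congr rfl fun k hk => hblock k (Finset.mem_range.1 hk), hcover, mul_one]
  refine ⟨hsum, fun fH hfH x hx => ?_⟩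
  rw [← hfH x hx]
  exact Finset.sum_congr rfl fun q hq => hsum q (by grind) x hx
end

section
/- (Eq. 19) For every q ∈ {0,…,Q} and every s ∈ {0,…,S_max}, the constructed function has the same integral as the original one: ∫_{h_min}^{h_max} y_M(q,s,h) dh = ∫_{h_min}^{h_max} g(q,s,h) dh. -/
open MeasureTheory

/-- Adjacent cells of the uniform partition of `(a, b]` into `M` pieces add up to the whole. -/
theorem sum_setIntegral_uniform_partition {f : ℝ → ℝ} {a b : ℝ} {M : ℕ} (hab : a ≤ b)
    (hM : 0 < M) (hf : IntegrableOn f (Set.Ioc a b)) {l r : ℕ → ℝ}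
    (hl : ∀ k : ℕ, l k = a + ((k : ℝ) - 1) * (b - a) / M)
    (hr : ∀ k : ℕ, r k = a + (k : ℝ) * (b - a) / M) :
    ∑ k ∈ Finset.Icc 1 M, ∫ x in Set.Ioc (l k) (r k), f x = ∫ x in Set.Ioc a b, f x := by
  have hM' : (0 : ℝ) < M := by exact_mod_cast hM
  have hr0 : r 0 = a := by simp [hr]
  have hrM : r M = b := by rw [hr]; field_simp; ring
  have hmono : Monotone r := fun i j hij => by
    have : (i : ℝ) ≤ j := by exact_mod_cast hij
    have := sub_nonneg.2 hab
    rw [hr, hr]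
    gcongr
  have hsucc : ∀ k, l (k + 1) = r k := fun k => by rw [hl, hr]; push_cast; ring
  have hsum := intervalIntegral.sum_integral_adjacent_intervals (f := f) (a := r) (n := M)
    (μ := volume) fun k hk => by
      rw [intervalIntegrable_iff_integrableOn_Ioc_of_le (hmono k.le_succ)]
      refine hf.mono_set (Set.Ioc_subset_Ioc ?_ ?_)
      · exact hr0 ▸ hmono k.zero_le
      · exact hrM ▸ hmono (Nat.succ_le_of_lt hk)
  rw [hr0, hrM, intervalIntegral.integral_of_le hab] at hsum
  rw [← hsum, ← Finset.Ico_add_one_right_eq_Icc, Finset.sum_Ico_eq_sum_range]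
  refine Finset.sum_congr (by simp) fun k _ => ?_
  rw [intervalIntegral.integral_of_le (hmono k.le_succ), add_comm 1 k, hsucc]

/-- A primitive of an integrable function recovers its set integrals over subintervals. -/
theorem setIntegral_Ioc_eq_sub_of_primitive {f U : ℝ → ℝ} {a b c d : ℝ}
    (hf : IntegrableOn f (Set.Ioc a b))
    (hU : ∀ x ∈ Set.Icc a b, U x = ∫ t in Set.Ioc a x, f t)
    (hc : a ≤ c) (hcd : c ≤ d) (hd : d ≤ b) :
    ∫ t in Set.Ioc c d, f t = U d - U c := by
  have hint : ∀ x, a ≤ x → x ≤ b → IntervalIntegrable f volume a x := fun x hax hxb =>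
    (intervalIntegrable_iff_integrableOn_Ioc_of_le hax).2
      (hf.mono_set (Set.Ioc_subset_Ioc_right hxb))
  rw [hU d ⟨hc.trans hcd, hd⟩, hU c ⟨hc, hcd.trans hd⟩,
    ← intervalIntegral.integral_of_le hcd, ← intervalIntegral.integral_of_le hc,
    ← intervalIntegral.integral_of_le (hc.trans hcd)]
  exact (intervalIntegral.integral_interval_sub_left (hint d (hc.trans hcd) hd)
    (hint c hc (hcd.trans hd))).symm

theorem stmt_7
    (hmin hmax : ℝ) (Q Smax M : ℕ)
    (h0 : 0 < hmin) (h1 : hmin < hmax) (hM : 0 < M)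
    (hkmin hkmax : ℕ → ℝ)
    (hhkmin : ∀ k : ℕ, hkmin k = hmin + ((k : ℝ) - 1) * (hmax - hmin) / M)
    (hhkmax : ∀ k : ℕ, hkmax k = hmin + (k : ℝ) * (hmax - hmin) / M)
    (g : ℕ → ℕ → ℝ → ℝ)
    (hg_nonneg : ∀ q, q ≤ Q → ∀ s, s ≤ Smax → ∀ x : ℝ, 0 ≤ g q s x)
    (hg_meas : ∀ q, q ≤ Q → ∀ s, s ≤ Smax → Measurable (g q s))
    (hg_int : ∀ q, q ≤ Q → ∀ s, s ≤ Smax → IntegrableOn (g q s) (Set.Ioc hmin hmax))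
    (U : ℕ → ℝ → ℝ)
    (hU : ∀ q, q ≤ Q → ∀ x ∈ Set.Icc hmin hmax,
        U q x = ∫ t in Set.Ioc hmin x, ∑ s ∈ Finset.range (Smax + 1), g q s t)
    (V : ℕ → ℝ → ℝ)
    (hV_mono : ∀ q, q ≤ Q → Monotone (V q))
    (hVU : ∀ q, q ≤ Q → ∀ x ∈ Set.Icc hmin hmax, V q (U q x) = x)
    (hUV : ∀ q, q ≤ Q → ∀ t ∈ Set.Icc 0 (U q hmax), U q (V q t) = t)
    (hVmem : ∀ q, q ≤ Q → ∀ t ∈ Set.Icc 0 (U q hmax), V q t ∈ Set.Icc hmin hmax)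
    (Hmax Hmin : ℕ → ℕ → ℕ → ℝ)
    (hHmax : ∀ k s q, Hmax k s q = V q (U q (hkmin k) +
        ∫ t in Set.Ioc (hkmin k) (hkmax k), ∑ x ∈ Finset.range (s + 1), g q x t))
    (hHmin0 : ∀ k q, Hmin k 0 q = hkmin k)
    (hHminS : ∀ k s q, Hmin k (s + 1) q = Hmax k s q)
    (y : ℕ → ℕ → ℝ → ℝ)
    (hy : ∀ q s (x : ℝ), y q s x = ∑ k ∈ Finset.Icc 1 M,
        (∑ j ∈ Finset.range (Smax + 1), g q j x) *
          (if x ∈ Set.Ioc (Hmin k s q) (Hmax k s q) then (1 : ℝ) else 0))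
 :
    ∀ q, q ≤ Q → ∀ s, s ≤ Smax →
      ∫ x in Set.Ioc hmin hmax, y q s x = ∫ x in Set.Ioc hmin hmax, g q s x := by
  intro q hq s hs
  have hM' : (0 : ℝ) < M := by exact_mod_cast hM
  have hsum_int : ∀ n ≤ Smax + 1,
      IntegrableOn (fun t => ∑ x ∈ Finset.range n, g q x t) (Set.Ioc hmin hmax) := fun n hn =>
    integrable_finsetSum _ fun i hi => hg_int q hq i (by have := Finset.mem_range.1 hi; omega)
  have hG_int := hsum_int (Smax + 1) le_rfl
  have hU_sub : ∀ {c d}, hmin ≤ c → c ≤ d → d ≤ hmax →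
      ∫ t in Set.Ioc c d, ∑ j ∈ Finset.range (Smax + 1), g q j t = U q d - U q c :=
    setIntegral_Ioc_eq_sub_of_primitive hG_int (hU q hq)
  have hG_nonneg : ∀ n ≤ Smax + 1, ∀ t, 0 ≤ ∑ j ∈ Finset.range n, g q j t := fun n hn t =>
    Finset.sum_nonneg fun i hi => hg_nonneg q hq i (by have := Finset.mem_range.1 hi; omega) t
  have hU_mono : ∀ {c d}, hmin ≤ c → c ≤ d → d ≤ hmax → U q c ≤ U q d := fun hc hcd hd =>
    sub_nonneg.1 (hU_sub hc hcd hd ▸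
      integral_nonneg fun t => hG_nonneg _ le_rfl t)
  have hU_min : U q hmin = 0 := by rw [hU q hq hmin ⟨le_rfl, h1.le⟩]; simp
  set P : ℕ → ℕ → ℝ := fun k n => U q (hkmin k) +
    ∫ t in Set.Ioc (hkmin k) (hkmax k), ∑ x ∈ Finset.range n, g q x t with hP
  have hcell : ∀ k ∈ Finset.Icc 1 M, hmin ≤ hkmin k ∧ hkmin k ≤ hkmax k ∧ hkmax k ≤ hmax := by
    intro k hk
    obtain ⟨hk1, hkM⟩ := Finset.mem_Icc.1 hk
    have hk1' : (1 : ℝ) ≤ k := by exact_mod_cast hk1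
    have hkM' : (k : ℝ) ≤ M := by exact_mod_cast hkM
    have hpos : 0 < hmax - hmin := sub_pos.2 h1
    rw [hhkmin, hhkmax]
    refine ⟨?_, ?_, ?_⟩
    · have : 0 ≤ ((k : ℝ) - 1) * (hmax - hmin) / M :=
        div_nonneg (mul_nonneg (by linarith) hpos.le) hM'.le
      linarith
    · gcongr
      linarith
    · have : (k : ℝ) * (hmax - hmin) / M ≤ hmax - hmin := by
        rw [div_le_iff₀ hM', mul_comm]
        gcongr
      linarith
  have hcell_int : ∀ k ∈ Finset.Icc 1 M, ∀ {f : ℝ → ℝ}, IntegrableOn f (Set.Ioc hmin hmax) →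
      IntegrableOn f (Set.Ioc (hkmin k) (hkmax k)) := fun k hk _ hf =>
    hf.mono_set (Set.Ioc_subset_Ioc (hcell k hk).1 (hcell k hk).2.2)
  have hP_succ : ∀ k ∈ Finset.Icc 1 M, ∀ n ≤ Smax,
      P k (n + 1) = P k n + ∫ t in Set.Ioc (hkmin k) (hkmax k), g q n t := by
    intro k hk n hn
    simp only [hP, Finset.sum_range_succ]
    rw [integral_add (hcell_int k hk (hsum_int n (by omega))) (hcell_int k hk (hg_int q hq n hn)),
      add_assoc]
  have hP_mem : ∀ k ∈ Finset.Icc 1 M, ∀ n ≤ Smax + 1, P k n ∈ Set.Icc 0 (U q hmax) := by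
    intro k hk n hn
    obtain ⟨hk1, hk2, hk3⟩ := hcell k hk
    have hle : ∫ t in Set.Ioc (hkmin k) (hkmax k), ∑ x ∈ Finset.range n, g q x t ≤
        U q (hkmax k) - U q (hkmin k) := by
      rw [← hU_sub hk1 hk2 hk3]
      refine integral_mono (hcell_int k hk (hsum_int n hn)) (hcell_int k hk hG_int) fun t => ?_
      exact Finset.sum_le_sum_of_subset_of_nonneg (Finset.range_mono hn) fun i hi _ =>
        hg_nonneg q hq i (by have := Finset.mem_range.1 hi; omega) t
    have hnn : 0 ≤ ∫ t in Set.Ioc (hkmin k) (hkmax k), ∑ x ∈ Finset.range n, g q x t :=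
      integral_nonneg fun t => hG_nonneg n hn t
    have hlow := hU_mono le_rfl hk1 (hk2.trans hk3)
    have hhigh := hU_mono (hk1.trans hk2) hk3 le_rfl
    constructor <;> simp only [hP] <;> linarith
  have hHmin : ∀ k ∈ Finset.Icc 1 M, Hmin k s q = V q (P k s) := by
    intro k hk
    obtain ⟨hk1, hk2, hk3⟩ := hcell k hk
    cases s with
    | zero => simp [hP, hHmin0, hVU q hq _ ⟨hk1, hk2.trans hk3⟩]
    | succ n => rw [hHminS, hHmax]
  have hpiece : ∀ k ∈ Finset.Icc 1 M,
      ∫ x in Set.Ioc (Hmin k s q) (Hmax k s q), ∑ j ∈ Finset.range (Smax + 1), g q j x =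
        ∫ x in Set.Ioc (hkmin k) (hkmax k), g q s x := by
    intro k hk
    have hmem := hP_mem k hk s (by omega)
    have hmem' := hP_mem k hk (s + 1) (by omega)
    have hstep := hP_succ k hk s hs
    have hnn : 0 ≤ ∫ t in Set.Ioc (hkmin k) (hkmax k), g q s t :=
      integral_nonneg fun t => hg_nonneg q hq s hs t
    rw [hHmin k hk, hHmax, hU_sub (hVmem q hq _ hmem).1 (hV_mono q hq (by linarith))
      (hVmem q hq _ hmem').2, hUV q hq _ hmem, hUV q hq _ hmem', hstep]
    ring
  have hsub : ∀ k ∈ Finset.Icc 1 M,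
      Set.Ioc (Hmin k s q) (Hmax k s q) ⊆ Set.Ioc hmin hmax := fun k hk => by
    rw [hHmin k hk, hHmax]
    exact Set.Ioc_subset_Ioc (hVmem q hq _ (hP_mem k hk s (by omega))).1
      (hVmem q hq _ (hP_mem k hk (s + 1) (by omega))).2
  have hind : ∀ k x, (∑ j ∈ Finset.range (Smax + 1), g q j x) *
      (if x ∈ Set.Ioc (Hmin k s q) (Hmax k s q) then (1 : ℝ) else 0) =
      (Set.Ioc (Hmin k s q) (Hmax k s q)).indicator
        (fun x => ∑ j ∈ Finset.range (Smax + 1), g q j x) x := fun k x => by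
    simp only [Set.indicator_apply, mul_ite, mul_one, mul_zero]
  simp only [hy, hind]
  rw [integral_finsetSum _ fun k _ => hG_int.indicator measurableSet_Ioc,
    ← sum_setIntegral_uniform_partition h1.le hM (hg_int q hq s hs) hhkmin hhkmax]
  refine Finset.sum_congr rfl fun k hk => ?_
  rw [setIntegral_indicator measurableSet_Ioc, Set.inter_eq_right.2 (hsub k hk), hpiece k hk]
end

section
/- (Lemma 2) Let A ≤ S_max be a natural number and α_0, …, α_A real numbers, and extend g and y_M by setting g(q',s,h) = 0 and y_M(q',s,h) = 0 whenever q' ∉ {0,…,Q}. If g satisfies the balance equations Σ_{k=0}^{A} Σ_{s=0}^{S_max} α_k ∫_{h_min}^{h_max} g(q+s−k, s, h) dh = Σ_{s=0}^{S_max} ∫_{h_min}^{h_max} g(q, s, h) dh for every q ∈ {0,…,Q}, then y_M satisfies the same balance equations: Σ_{k=0}^{A} Σ_{s=0}^{S_max} α_k ∫_{h_min}^{h_max} y_M(q+s−k, s, h) dh = Σ_{s=0}^{S_max} ∫_{h_min}^{h_max} y_M(q, s, h) dh for every q ∈ {0,…,Q}. -/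
open MeasureTheory

/-- Total mass profile: the mass of `G` over `(x, y]` is the increment of its primitive `u`. -/
lemma setIntegral_Ioc_eq_sub_of_primitive_s8 {lo hi : ℝ} {G u : ℝ → ℝ}
    (hG : IntegrableOn G (Set.Ioc lo hi))
    (hu : ∀ x ∈ Set.Icc lo hi, u x = ∫ t in Set.Ioc lo x, G t)
    {x y : ℝ} (hx : x ∈ Set.Icc lo hi) (hy : y ∈ Set.Icc lo hi) (hxy : x ≤ y) :
    ∫ t in Set.Ioc x y, G t = u y - u x := by
  rw [hu x hx, hu y hy, ← Set.Ioc_union_Ioc_eq_Ioc hx.1 hxy,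
    setIntegral_union (Set.Ioc_disjoint_Ioc_of_le le_rfl) measurableSet_Ioc
      (hG.mono_set (Set.Ioc_subset_Ioc_right hx.2)) (hG.mono_set (Set.Ioc_subset_Ioc hx.1 hy.2))]
  ring

/-- Inside a cell `(a, b]`, the interval between consecutive quantiles carries exactly the mass of
the corresponding summand. -/
lemma setIntegral_Ioc_quantile {lo hi a b : ℝ} {n s : ℕ} {f : ℕ → ℝ → ℝ} {u v : ℝ → ℝ}
    (hf0 : ∀ j ≤ n, ∀ x, 0 ≤ f j x) (hfi : ∀ j ≤ n, IntegrableOn (f j) (Set.Ioc lo hi))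
    (hu : ∀ x ∈ Set.Icc lo hi, u x = ∫ t in Set.Ioc lo x, ∑ j ∈ Finset.range (n + 1), f j t)
    (hv : Monotone v) (huv : ∀ t ∈ Set.Icc 0 (u hi), u (v t) = t)
    (hvmem : ∀ t ∈ Set.Icc 0 (u hi), v t ∈ Set.Icc lo hi)
    (ha : lo ≤ a) (hab : a ≤ b) (hb : b ≤ hi) (hs : s ≤ n) {c d : ℝ}
    (hc : c = v (u a + ∫ t in Set.Ioc a b, ∑ j ∈ Finset.range s, f j t))
    (hd : d = v (u a + ∫ t in Set.Ioc a b, ∑ j ∈ Finset.range (s + 1), f j t)) :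
    Set.Ioc c d ⊆ Set.Ioc lo hi ∧
      ∫ t in Set.Ioc c d, ∑ j ∈ Finset.range (n + 1), f j t = ∫ t in Set.Ioc a b, f s t := by
  have hint : ∀ p ≤ n + 1,
      IntegrableOn (fun t => ∑ j ∈ Finset.range p, f j t) (Set.Ioc lo hi) := fun p hp =>
    integrable_finsetSum _ fun j hj => hfi j (by have := Finset.mem_range.1 hj; omega)
  have hsub : Set.Ioc a b ⊆ Set.Ioc lo hi := Set.Ioc_subset_Ioc ha hb
  have hmass : ∀ p ≤ n + 1, (∫ t in Set.Ioc a b, ∑ j ∈ Finset.range p, f j t)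
      = ∑ j ∈ Finset.range p, ∫ t in Set.Ioc a b, f j t := fun p hp =>
    integral_finsetSum _ fun j hj =>
      (hfi j (by have := Finset.mem_range.1 hj; omega)).mono_set hsub
  have hpos : ∀ j ≤ n, 0 ≤ ∫ t in Set.Ioc a b, f j t := fun j hj =>
    setIntegral_nonneg measurableSet_Ioc fun x _ => hf0 j hj x
  have hGpos : ∀ x, 0 ≤ ∑ j ∈ Finset.range (n + 1), f j x := fun x =>
    Finset.sum_nonneg fun j hj => hf0 j (by have := Finset.mem_range.1 hj; omega) x
  have haI : a ∈ Set.Icc lo hi := ⟨ha, hab.trans hb⟩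
  have hbI : b ∈ Set.Icc lo hi := ⟨ha.trans hab, hb⟩
  have hhI : hi ∈ Set.Icc lo hi := ⟨ha.trans (hab.trans hb), le_rfl⟩
  have hua : 0 ≤ u a := by
    rw [hu a haI]; exact setIntegral_nonneg measurableSet_Ioc fun x _ => hGpos x
  have hab' := setIntegral_Ioc_eq_sub_of_primitive_s8 (hint _ le_rfl) hu haI hbI hab
  have hbh := setIntegral_Ioc_eq_sub_of_primitive_s8 (hint _ le_rfl) hu hbI hhI hb
  have hbh0 : 0 ≤ u hi - u b := by
    rw [← hbh]; exact setIntegral_nonneg measurableSet_Ioc fun x _ => hGpos x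
  have hmem : ∀ p ≤ n + 1,
      u a + (∫ t in Set.Ioc a b, ∑ j ∈ Finset.range p, f j t) ∈ Set.Icc 0 (u hi) := by
    intro p hp
    rw [hmass p hp]
    rw [hmass _ le_rfl] at hab'
    have hp0 : 0 ≤ ∑ j ∈ Finset.range p, ∫ t in Set.Ioc a b, f j t :=
      Finset.sum_nonneg fun j hj => hpos j (by have := Finset.mem_range.1 hj; omega)
    have hple : ∑ j ∈ Finset.range p, ∫ t in Set.Ioc a b, f j t
        ≤ ∑ j ∈ Finset.range (n + 1), ∫ t in Set.Ioc a b, f j t :=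
      Finset.sum_le_sum_of_subset_of_nonneg (Finset.range_mono hp) fun j hj _ =>
        hpos j (by have := Finset.mem_range.1 hj; omega)
    constructor <;> linarith
  have hms := hmem s (by omega)
  have hms' := hmem (s + 1) (by omega)
  have hstep : (∫ t in Set.Ioc a b, ∑ j ∈ Finset.range (s + 1), f j t)
      = (∫ t in Set.Ioc a b, ∑ j ∈ Finset.range s, f j t) + ∫ t in Set.Ioc a b, f s t := by
    rw [hmass _ (by omega), hmass _ (by omega), Finset.sum_range_succ]
  have hcI : c ∈ Set.Icc lo hi := hc ▸ hvmem _ hms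
  have hdI : d ∈ Set.Icc lo hi := hd ▸ hvmem _ hms'
  have hcd : c ≤ d := by
    rw [hc, hd]; exact hv (by linarith [hpos s hs])
  refine ⟨Set.Ioc_subset_Ioc hcI.1 hdI.2, ?_⟩
  rw [setIntegral_Ioc_eq_sub_of_primitive_s8 (hint _ le_rfl) hu hcI hdI hcd, hc, hd,
    huv _ hms, huv _ hms', hstep]
  ring

/-- The integral over `(p 0, p M]` is the sum of the integrals over the cells of a monotone
partition. -/
lemma sum_setIntegral_Ioc_partition {p : ℕ → ℝ} (hp : Monotone p) {M : ℕ} {f : ℝ → ℝ}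
    (hf : IntegrableOn f (Set.Ioc (p 0) (p M))) :
    ∑ k ∈ Finset.range M, ∫ t in Set.Ioc (p k) (p (k + 1)), f t
      = ∫ t in Set.Ioc (p 0) (p M), f t := by
  rw [← intervalIntegral.integral_of_le (hp M.zero_le),
    ← intervalIntegral.sum_integral_adjacent_intervals fun k hk =>
      (intervalIntegrable_iff_integrableOn_Ioc_of_le (hp k.le_succ)).2
        (hf.mono_set (Set.Ioc_subset_Ioc (hp k.zero_le) (hp hk)))]
  exact Finset.sum_congr rfl fun k _ =>
    (intervalIntegral.integral_of_le (hp k.le_succ)).symm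

theorem stmt_8
    (hmin hmax : ℝ) (Q Smax M : ℕ)
    (h0 : 0 < hmin) (h1 : hmin < hmax) (hM : 0 < M)
    (hkmin hkmax : ℕ → ℝ)
    (hhkmin : ∀ k : ℕ, hkmin k = hmin + ((k : ℝ) - 1) * (hmax - hmin) / M)
    (hhkmax : ∀ k : ℕ, hkmax k = hmin + (k : ℝ) * (hmax - hmin) / M)
    (g : ℤ → ℕ → ℝ → ℝ)
    (hg_nonneg : ∀ q : ℤ, 0 ≤ q → q ≤ Q → ∀ s, s ≤ Smax → ∀ x : ℝ, 0 ≤ g q s x)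
    (hg_meas : ∀ q : ℤ, 0 ≤ q → q ≤ Q → ∀ s, s ≤ Smax → Measurable (g q s))
    (hg_int : ∀ q : ℤ, 0 ≤ q → q ≤ Q → ∀ s, s ≤ Smax →
        IntegrableOn (g q s) (Set.Ioc hmin hmax))
    (hg_ext : ∀ q : ℤ, (q < 0 ∨ (Q : ℤ) < q) → ∀ (s : ℕ) (x : ℝ), g q s x = 0)
    (U : ℤ → ℝ → ℝ)
    (hU : ∀ q : ℤ, 0 ≤ q → q ≤ Q → ∀ x ∈ Set.Icc hmin hmax,
        U q x = ∫ t in Set.Ioc hmin x, ∑ s ∈ Finset.range (Smax + 1), g q s t)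
    (V : ℤ → ℝ → ℝ)
    (hV_mono : ∀ q : ℤ, 0 ≤ q → q ≤ Q → Monotone (V q))
    (hVU : ∀ q : ℤ, 0 ≤ q → q ≤ Q → ∀ x ∈ Set.Icc hmin hmax, V q (U q x) = x)
    (hUV : ∀ q : ℤ, 0 ≤ q → q ≤ Q → ∀ t ∈ Set.Icc 0 (U q hmax), U q (V q t) = t)
    (hVmem : ∀ q : ℤ, 0 ≤ q → q ≤ Q → ∀ t ∈ Set.Icc 0 (U q hmax),
        V q t ∈ Set.Icc hmin hmax)
    (Hmax Hmin : ℕ → ℕ → ℤ → ℝ)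
    (hHmax : ∀ (k s : ℕ) (q : ℤ), Hmax k s q = V q (U q (hkmin k) +
        ∫ t in Set.Ioc (hkmin k) (hkmax k), ∑ x ∈ Finset.range (s + 1), g q x t))
    (hHmin0 : ∀ (k : ℕ) (q : ℤ), Hmin k 0 q = hkmin k)
    (hHminS : ∀ (k s : ℕ) (q : ℤ), Hmin k (s + 1) q = Hmax k s q)
    (y : ℤ → ℕ → ℝ → ℝ)
    (hy : ∀ q : ℤ, 0 ≤ q → q ≤ Q → ∀ (s : ℕ) (x : ℝ),
        y q s x = ∑ k ∈ Finset.Icc 1 M,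
          (∑ j ∈ Finset.range (Smax + 1), g q j x) *
            (if x ∈ Set.Ioc (Hmin k s q) (Hmax k s q) then (1 : ℝ) else 0))
    (hy_ext : ∀ q : ℤ, (q < 0 ∨ (Q : ℤ) < q) → ∀ (s : ℕ) (x : ℝ), y q s x = 0)
    (A : ℕ) (hA : A ≤ Smax) (α : ℕ → ℝ)
    (hbal : ∀ q : ℤ, 0 ≤ q → q ≤ Q →
      ∑ k ∈ Finset.range (A + 1), ∑ s ∈ Finset.range (Smax + 1),
        α k * ∫ x in Set.Ioc hmin hmax, g (q + s - k) s x =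
      ∑ s ∈ Finset.range (Smax + 1), ∫ x in Set.Ioc hmin hmax, g q s x) :
    ∀ q : ℤ, 0 ≤ q → q ≤ Q →
      ∑ k ∈ Finset.range (A + 1), ∑ s ∈ Finset.range (Smax + 1),
        α k * ∫ x in Set.Ioc hmin hmax, y (q + s - k) s x =
      ∑ s ∈ Finset.range (Smax + 1), ∫ x in Set.Ioc hmin hmax, y q s x := by
  have hMR : (0 : ℝ) < M := by exact_mod_cast hM
  have hmono : Monotone hkmax := by
    intro i j hij
    rw [hhkmax, hhkmax]
    have : (i : ℝ) ≤ j := by exact_mod_cast hij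
    have : 0 ≤ hmax - hmin := by linarith
    gcongr
  have hmax0 : hkmax 0 = hmin := by rw [hhkmax]; simp
  have hmaxM : hkmax M = hmax := by rw [hhkmax]; field_simp; ring
  have hmin_succ : ∀ k, hkmin (k + 1) = hkmax k := by
    intro k; rw [hhkmin, hhkmax]; push_cast; ring
  have key : ∀ (q : ℤ) (s : ℕ), s ≤ Smax →
      ∫ x in Set.Ioc hmin hmax, y q s x = ∫ x in Set.Ioc hmin hmax, g q s x := by
    intro q s hs
    by_cases hq : 0 ≤ q ∧ q ≤ Q
    swap
    · have hq' : q < 0 ∨ (Q : ℤ) < q := by omega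
      simp only [hy_ext q hq', hg_ext q hq']
    obtain ⟨hq0, hqQ⟩ := hq
    have hcell : ∀ k ∈ Finset.range M,
        Set.Ioc (Hmin (k + 1) s q) (Hmax (k + 1) s q) ⊆ Set.Ioc hmin hmax ∧
        ∫ t in Set.Ioc (Hmin (k + 1) s q) (Hmax (k + 1) s q),
          ∑ j ∈ Finset.range (Smax + 1), g q j t
          = ∫ t in Set.Ioc (hkmax k) (hkmax (k + 1)), g q s t := by
      intro k hk
      have hlo : hmin ≤ hkmax k := hmax0 ▸ hmono k.zero_le
      have hhi : hkmax (k + 1) ≤ hmax := hmaxM ▸ hmono (Finset.mem_range.1 hk)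
      have hle : hkmax k ≤ hkmax (k + 1) := hmono k.le_succ
      refine setIntegral_Ioc_quantile (hg_nonneg q hq0 hqQ) (hg_int q hq0 hqQ) (hU q hq0 hqQ)
        (hV_mono q hq0 hqQ) (hUV q hq0 hqQ) (hVmem q hq0 hqQ) hlo hle hhi hs ?_ ?_
      · cases s with
        | zero =>
          simp [hHmin0, hmin_succ, hVU q hq0 hqQ _ ⟨hlo, hle.trans hhi⟩]
        | succ s => rw [hHminS, hHmax, hmin_succ]
      · rw [hHmax, hmin_succ]
    have hG : IntegrableOn (fun t => ∑ j ∈ Finset.range (Smax + 1), g q j t)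
        (Set.Ioc hmin hmax) :=
      integrable_finsetSum _ fun j hj =>
        hg_int q hq0 hqQ j (by have := Finset.mem_range.1 hj; omega)
    have hyind : ∀ x, y q s x = ∑ k ∈ Finset.range M,
        (Set.Ioc (Hmin (k + 1) s q) (Hmax (k + 1) s q)).indicator
          (fun t => ∑ j ∈ Finset.range (Smax + 1), g q j t) x := by
      intro x
      rw [hy q hq0 hqQ, ← Finset.Ico_succ_right_eq_Icc, Finset.sum_Ico_eq_sum_range]
      refine Finset.sum_congr (by simp) fun k _ => ?_
      rw [add_comm 1 k, Set.indicator_apply, mul_ite, mul_one, mul_zero]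
    simp only [hyind]
    rw [integral_finsetSum _ fun k _ => hG.indicator measurableSet_Ioc]
    have hpart := sum_setIntegral_Ioc_partition hmono (M := M) (f := g q s)
      (by rw [hmax0, hmaxM]; exact hg_int q hq0 hqQ s hs)
    rw [hmax0, hmaxM] at hpart
    rw [← hpart]
    refine Finset.sum_congr rfl fun k hk => ?_
    rw [setIntegral_indicator measurableSet_Ioc, Set.inter_eq_right.2 (hcell k hk).1,
      (hcell k hk).2]
  intro q hq0 hqQ
  have hs_le : ∀ s ∈ Finset.range (Smax + 1), s ≤ Smax := fun s hs =>
    Nat.lt_succ_iff.1 (Finset.mem_range.1 hs)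
  rw [Finset.sum_congr rfl fun k _ => Finset.sum_congr rfl fun s hs => by
      rw [key (q + s - k) s (hs_le s hs)],
    Finset.sum_congr rfl fun s hs => key q s (hs_le s hs)]
  exact hbal q hq0 hqQ
end

section
/- (Lemma 3) Let ā > 0 and D_th ≥ 0 be real numbers. If (1/ā) · ∫_{h_min}^{h_max} Σ_{s=0}^{S_max} Σ_{q=0}^{Q} q · g(q,s,h) dh ≤ D_th, then (1/ā) · ∫_{h_min}^{h_max} Σ_{s=0}^{S_max} Σ_{q=0}^{Q} q · y_M(q,s,h) dh ≤ D_th; in fact the two integrals are equal. -/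
open MeasureTheory

/-- Indicators of consecutive half-open intervals add up to the indicator of their union. -/
theorem sum_range_ite_mem_Ioc (a : ℕ → ℝ) (n : ℕ) (ha : ∀ i < n, a i ≤ a (i + 1)) (x : ℝ) :
    ∑ i ∈ Finset.range n, (if x ∈ Set.Ioc (a i) (a (i + 1)) then (1 : ℝ) else 0) =
      if x ∈ Set.Ioc (a 0) (a n) then 1 else 0 := by
  have h0n : ∀ m ≤ n, a 0 ≤ a m := by
    intro m hm
    induction m with
    | zero => exact le_rfl
    | succ m ih => exact (ih (by omega)).trans (ha m (by omega))
  induction n with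
  | zero => simp
  | succ n ih =>
    rw [Finset.sum_range_succ, ih (fun i hi => ha i (by omega)) (fun m hm => h0n m (by omega))]
    have h1 := h0n n (by omega)
    have h2 := ha n (by omega)
    simp only [Set.mem_Ioc]
    split_ifs <;> grind

theorem stmt_9
    (hmin hmax : ℝ) (Q Smax M : ℕ)
    (h0 : 0 < hmin) (h1 : hmin < hmax) (hM : 0 < M)
    (hkmin hkmax : ℕ → ℝ)
    (hhkmin : ∀ k : ℕ, hkmin k = hmin + ((k : ℝ) - 1) * (hmax - hmin) / M)
    (hhkmax : ∀ k : ℕ, hkmax k = hmin + (k : ℝ) * (hmax - hmin) / M)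
    (g : ℕ → ℕ → ℝ → ℝ)
    (hg_nonneg : ∀ q, q ≤ Q → ∀ s, s ≤ Smax → ∀ x : ℝ, 0 ≤ g q s x)
    (hg_meas : ∀ q, q ≤ Q → ∀ s, s ≤ Smax → Measurable (g q s))
    (hg_int : ∀ q, q ≤ Q → ∀ s, s ≤ Smax → IntegrableOn (g q s) (Set.Ioc hmin hmax))
    (U : ℕ → ℝ → ℝ)
    (hU : ∀ q, q ≤ Q → ∀ x ∈ Set.Icc hmin hmax,
        U q x = ∫ t in Set.Ioc hmin x, ∑ s ∈ Finset.range (Smax + 1), g q s t)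
    (V : ℕ → ℝ → ℝ)
    (hV_mono : ∀ q, q ≤ Q → Monotone (V q))
    (hVU : ∀ q, q ≤ Q → ∀ x ∈ Set.Icc hmin hmax, V q (U q x) = x)
    (hUV : ∀ q, q ≤ Q → ∀ t ∈ Set.Icc 0 (U q hmax), U q (V q t) = t)
    (hVmem : ∀ q, q ≤ Q → ∀ t ∈ Set.Icc 0 (U q hmax), V q t ∈ Set.Icc hmin hmax)
    (Hmax Hmin : ℕ → ℕ → ℕ → ℝ)
    (hHmax : ∀ k s q, Hmax k s q = V q (U q (hkmin k) +
        ∫ t in Set.Ioc (hkmin k) (hkmax k), ∑ x ∈ Finset.range (s + 1), g q x t))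
    (hHmin0 : ∀ k q, Hmin k 0 q = hkmin k)
    (hHminS : ∀ k s q, Hmin k (s + 1) q = Hmax k s q)
    (y : ℕ → ℕ → ℝ → ℝ)
    (hy : ∀ q s (x : ℝ), y q s x = ∑ k ∈ Finset.Icc 1 M,
        (∑ j ∈ Finset.range (Smax + 1), g q j x) *
          (if x ∈ Set.Ioc (Hmin k s q) (Hmax k s q) then (1 : ℝ) else 0))
    (abar Dth : ℝ) (habar : 0 < abar) (hDth : 0 ≤ Dth)
    (hdelay : (1 / abar) * ∫ x in Set.Ioc hmin hmax,
        ∑ s ∈ Finset.range (Smax + 1), ∑ q ∈ Finset.range (Q + 1),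
          (q : ℝ) * g q s x ≤ Dth) :
    (1 / abar) * (∫ x in Set.Ioc hmin hmax,
        ∑ s ∈ Finset.range (Smax + 1), ∑ q ∈ Finset.range (Q + 1),
          (q : ℝ) * y q s x) ≤ Dth ∧
    (∫ x in Set.Ioc hmin hmax,
        ∑ s ∈ Finset.range (Smax + 1), ∑ q ∈ Finset.range (Q + 1),
          (q : ℝ) * y q s x) =
      ∫ x in Set.Ioc hmin hmax,
        ∑ s ∈ Finset.range (Smax + 1), ∑ q ∈ Finset.range (Q + 1),
          (q : ℝ) * g q s x := by
  have hMR : (0 : ℝ) < M := by exact_mod_cast hM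
  have hstep : 0 ≤ (hmax - hmin) / M := div_nonneg (by linarith) hMR.le
  have hkmin_succ : ∀ k : ℕ, hkmin (k + 1) = hkmax k := by
    intro k
    rw [hhkmin, hhkmax]
    push_cast
    ring
  have hkmax_zero : hkmax 0 = hmin := by simp [hhkmax]
  have hkmax_M : hkmax M = hmax := by
    rw [hhkmax]
    field_simp
    ring
  have hkmax_mono : Monotone hkmax := by
    refine monotone_nat_of_le_succ fun k => ?_
    rw [hhkmax, hhkmax, mul_div_assoc, mul_div_assoc]
    push_cast
    nlinarith
  have hkmax_mem : ∀ k ≤ M, hkmax k ∈ Set.Icc hmin hmax := fun k hk =>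
    ⟨hkmax_zero ▸ hkmax_mono (Nat.zero_le k), hkmax_M ▸ hkmax_mono hk⟩
  have hsum_int : ∀ q ≤ Q, ∀ s ≤ Smax + 1, ∀ a b, hmin ≤ a → b ≤ hmax →
      IntegrableOn (fun t => ∑ x ∈ Finset.range s, g q x t) (Set.Ioc a b) := by
    intro q hq s hs a b ha hb
    refine integrable_finsetSum _ fun x hx => ?_
    have hx := Finset.mem_range.1 hx
    exact (hg_int q hq x (by omega)).mono_set (Set.Ioc_subset_Ioc ha hb)
  have hlevel : ∀ q ≤ Q, ∀ k < M, ∀ s ≤ Smax + 1, Hmin (k + 1) s q = V q (U q (hkmax k) +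
      ∫ t in Set.Ioc (hkmax k) (hkmax (k + 1)), ∑ x ∈ Finset.range s, g q x t) := by
    intro q hq k hk s _
    cases s with
    | zero =>
      simp [hHmin0, hkmin_succ, hVU q hq _ (hkmax_mem k hk.le)]
    | succ s => rw [hHminS, hHmax, hkmin_succ]
  have hlevel_mono : ∀ q ≤ Q, ∀ k < M, ∀ s < Smax + 1,
      Hmin (k + 1) s q ≤ Hmin (k + 1) (s + 1) q := by
    intro q hq k hk s hs
    rw [hlevel q hq k hk s hs.le, hlevel q hq k hk (s + 1) hs]
    refine hV_mono q hq (add_le_add le_rfl (integral_mono ?_ ?_ fun t => ?_))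
    · exact hsum_int q hq s hs.le _ _ (hkmax_mem k hk.le).1 (hkmax_mem (k + 1) hk).2
    · exact hsum_int q hq (s + 1) hs _ _ (hkmax_mem k hk.le).1 (hkmax_mem (k + 1) hk).2
    · simpa [Finset.sum_range_succ] using hg_nonneg q hq s (by omega) t
  have hlevel_top : ∀ q ≤ Q, ∀ k < M, Hmin (k + 1) (Smax + 1) q = hkmax (k + 1) := by
    intro q hq k hk
    have hk0 := hkmax_mem k hk.le
    have hk1 := hkmax_mem (k + 1) hk
    have hle := hkmax_mono (Nat.le_add_right k 1)
    rw [hlevel q hq k hk _ le_rfl, hU q hq _ hk0, ← setIntegral_union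
      (Set.Ioc_disjoint_Ioc_of_le le_rfl) measurableSet_Ioc
      (hsum_int q hq _ le_rfl _ _ le_rfl hk0.2) (hsum_int q hq _ le_rfl _ _ hk0.1 hk1.2),
      Set.Ioc_union_Ioc_eq_Ioc hk0.1 hle, ← hU q hq _ hk1, hVU q hq _ hk1]
  have hy_sum : ∀ q ≤ Q, ∀ x ∈ Set.Ioc hmin hmax,
      ∑ s ∈ Finset.range (Smax + 1), y q s x = ∑ s ∈ Finset.range (Smax + 1), g q s x := by
    intro q hq x hx
    have hcell : ∀ k ∈ Finset.range M,
        (∑ s ∈ Finset.range (Smax + 1),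
          if x ∈ Set.Ioc (Hmin (k + 1) s q) (Hmin (k + 1) (s + 1) q) then (1 : ℝ) else 0) =
        if x ∈ Set.Ioc (hkmax k) (hkmax (k + 1)) then 1 else 0 := by
      intro k hk
      have hk := Finset.mem_range.1 hk
      rw [sum_range_ite_mem_Ioc (fun s => Hmin (k + 1) s q) _ (hlevel_mono q hq k hk),
        hlevel_top q hq k hk, hHmin0, hkmin_succ]
    simp only [hy, ← hHminS]
    rw [Finset.sum_comm]
    simp only [← Finset.mul_sum]
    rw [← Finset.Ico_add_one_right_eq_Icc, Finset.sum_Ico_eq_sum_range]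
    simp only [Nat.add_sub_cancel, add_comm 1]
    rw [Finset.sum_congr rfl hcell,
      sum_range_ite_mem_Ioc hkmax M (fun i _ => hkmax_mono (Nat.le_add_right i 1)),
      hkmax_zero, hkmax_M, if_pos hx, mul_one]
  have heq : (∫ x in Set.Ioc hmin hmax,
        ∑ s ∈ Finset.range (Smax + 1), ∑ q ∈ Finset.range (Q + 1), (q : ℝ) * y q s x) =
      ∫ x in Set.Ioc hmin hmax,
        ∑ s ∈ Finset.range (Smax + 1), ∑ q ∈ Finset.range (Q + 1), (q : ℝ) * g q s x := by
    refine setIntegral_congr_fun measurableSet_Ioc fun x hx => ?_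
    rw [Finset.sum_comm, Finset.sum_comm (s := Finset.range (Smax + 1))]
    refine Finset.sum_congr rfl fun q hq => ?_
    rw [← Finset.mul_sum, ← Finset.mul_sum,
      hy_sum q (Nat.lt_succ_iff.1 (Finset.mem_range.1 hq)) x hx]
  exact ⟨heq ▸ hdelay, heq⟩
end

section
/- (Theorem 2: the constructed policy is deterministic) For every q ∈ {0,…,Q} and every h ∈ (h_min, h_max] such that Σ_{x=0}^{S_max} y_M(q,x,h) ≠ 0, and for every s ∈ {0,…,S_max}, the scheduling probability f_M(s|q,h) = y_M(q,s,h) / Σ_{x=0}^{S_max} y_M(q,x,h) takes only the values 0 or 1. -/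
open MeasureTheory

/-- The half-open intervals between consecutive values of a monotone sequence are disjoint. -/
theorem MonotoneOn.eq_of_mem_Ioc_succ {a : ℕ → ℝ} {N i j : ℕ} (ha : MonotoneOn a (Set.Iic N))
    (hi : i < N) (hj : j < N) {x : ℝ} (hxi : x ∈ Set.Ioc (a i) (a (i + 1)))
    (hxj : x ∈ Set.Ioc (a j) (a (j + 1))) : i = j := by
  rcases lt_trichotomy i j with h | h | h
  · exact absurd (hxi.2.trans (ha (Set.mem_Iic.2 hi) (Set.mem_Iic.2 hj.le) h)) hxj.1.not_ge
  · exact h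
  · exact absurd (hxj.2.trans (ha (Set.mem_Iic.2 hj) (Set.mem_Iic.2 hi.le) h)) hxi.1.not_ge

/-- Set integrals of partial sums of nonnegative integrable functions increase with the number of
terms. -/
theorem monotoneOn_setIntegral_sum_range {g : ℕ → ℝ → ℝ} {N : ℕ} {A : Set ℝ}
    (hg : ∀ s < N, ∀ x, 0 ≤ g s x) (hint : ∀ s < N, IntegrableOn (g s) A) :
    MonotoneOn (fun n => ∫ t in A, ∑ s ∈ Finset.range n, g s t) (Set.Iic N) := by
  intro m hm n hn hmn
  rw [Set.mem_Iic] at hm hn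
  have int (l : ℕ) (hl : l ≤ N) :
      IntegrableOn (fun t => ∑ s ∈ Finset.range l, g s t) A :=
    integrable_finsetSum _ fun s hs => hint s ((Finset.mem_range.1 hs).trans_le hl)
  refine integral_mono (int m hm) (int n hn) fun t => ?_
  exact Finset.sum_le_sum_of_subset_of_nonneg (Finset.range_mono hmn)
    fun s hs _ => hg s ((Finset.mem_range.1 hs).trans_le hn) t

theorem stmt_12
    (hmin hmax : ℝ) (Q Smax M : ℕ)
    (h0 : 0 < hmin) (h1 : hmin < hmax) (hM : 0 < M)
    (hkmin hkmax : ℕ → ℝ)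
    (hhkmin : ∀ k : ℕ, hkmin k = hmin + ((k : ℝ) - 1) * (hmax - hmin) / M)
    (hhkmax : ∀ k : ℕ, hkmax k = hmin + (k : ℝ) * (hmax - hmin) / M)
    (g : ℕ → ℕ → ℝ → ℝ)
    (hg_nonneg : ∀ q, q ≤ Q → ∀ s, s ≤ Smax → ∀ x : ℝ, 0 ≤ g q s x)
    (hg_meas : ∀ q, q ≤ Q → ∀ s, s ≤ Smax → Measurable (g q s))
    (hg_int : ∀ q, q ≤ Q → ∀ s, s ≤ Smax → IntegrableOn (g q s) (Set.Ioc hmin hmax))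
    (U : ℕ → ℝ → ℝ)
    (hU : ∀ q, q ≤ Q → ∀ x ∈ Set.Icc hmin hmax,
        U q x = ∫ t in Set.Ioc hmin x, ∑ s ∈ Finset.range (Smax + 1), g q s t)
    (V : ℕ → ℝ → ℝ)
    (hV_mono : ∀ q, q ≤ Q → Monotone (V q))
    (hVU : ∀ q, q ≤ Q → ∀ x ∈ Set.Icc hmin hmax, V q (U q x) = x)
    (hUV : ∀ q, q ≤ Q → ∀ t ∈ Set.Icc 0 (U q hmax), U q (V q t) = t)
    (hVmem : ∀ q, q ≤ Q → ∀ t ∈ Set.Icc 0 (U q hmax), V q t ∈ Set.Icc hmin hmax)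
    (Hmax Hmin : ℕ → ℕ → ℕ → ℝ)
    (hHmax : ∀ k s q, Hmax k s q = V q (U q (hkmin k) +
        ∫ t in Set.Ioc (hkmin k) (hkmax k), ∑ x ∈ Finset.range (s + 1), g q x t))
    (hHmin0 : ∀ k q, Hmin k 0 q = hkmin k)
    (hHminS : ∀ k s q, Hmin k (s + 1) q = Hmax k s q)
    (y : ℕ → ℕ → ℝ → ℝ)
    (hy : ∀ q s (x : ℝ), y q s x = ∑ k ∈ Finset.Icc 1 M,
        (∑ j ∈ Finset.range (Smax + 1), g q j x) *
          (if x ∈ Set.Ioc (Hmin k s q) (Hmax k s q) then (1 : ℝ) else 0))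
 :
    ∀ q, q ≤ Q → ∀ x ∈ Set.Ioc hmin hmax,
      (∑ j ∈ Finset.range (Smax + 1), y q j x) ≠ 0 →
      ∀ s, s ≤ Smax →
        y q s x / (∑ j ∈ Finset.range (Smax + 1), y q j x) = 0 ∨
        y q s x / (∑ j ∈ Finset.range (Smax + 1), y q j x) = 1 := by
  intro q hq x _ _ s hs
  have hMpos : (0 : ℝ) < M := by exact_mod_cast hM
  have hkmin_mono : Monotone hkmin := by
    intro i j hij
    rw [hhkmin, hhkmin]
    have : (i : ℝ) ≤ j := by exact_mod_cast hij
    have : 0 < hmax - hmin := sub_pos.2 h1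
    gcongr
  have hkmax_eq (k : ℕ) : hkmax k = hkmin (k + 1) := by
    rw [hhkmin, hhkmax]
    push_cast
    ring
  have hkmin_one : hkmin 1 = hmin := by simp [hhkmin]
  have hkmin_last : hkmin (M + 1) = hmax := by
    rw [hhkmin]
    push_cast
    field_simp
    ring
  have hkmin_mem (k : ℕ) (h : 1 ≤ k) (h' : k ≤ M + 1) : hkmin k ∈ Set.Icc hmin hmax :=
    ⟨hkmin_one ▸ hkmin_mono h, hkmin_last ▸ hkmin_mono h'⟩
  have hHmin (k : ℕ) (hk : k ∈ Finset.Icc 1 M) (n : ℕ) :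
      Hmin k n q = V q (U q (hkmin k) +
        ∫ t in Set.Ioc (hkmin k) (hkmax k), ∑ j ∈ Finset.range n, g q j t) := by
    rw [Finset.mem_Icc] at hk
    cases n with
    | zero => simp [hHmin0, hVU q hq _ (hkmin_mem k hk.1 (by lia))]
    | succ n => rw [hHminS, hHmax]
  have hHmono (k : ℕ) (hk : k ∈ Finset.Icc 1 M) :
      MonotoneOn (fun n => Hmin k n q) (Set.Iic (Smax + 1)) := by
    intro m hm n hn hmn
    have hk' := Finset.mem_Icc.1 hk
    simp only [hHmin k hk]
    refine hV_mono q hq (add_le_add le_rfl ?_)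
    refine monotoneOn_setIntegral_sum_range (fun j hj => hg_nonneg q hq j (by lia))
      (fun j hj => (hg_int q hq j (by lia)).mono_set (Set.Ioc_subset_Ioc ?_ ?_)) hm hn hmn
    · exact (hkmin_mem k hk'.1 (by lia)).1
    · rw [hkmax_eq]
      exact (hkmin_mem (k + 1) (by lia) (by lia)).2
  have hHlast (k : ℕ) (hk : k ∈ Finset.Icc 1 M) : Hmin k (Smax + 1) q = hkmin (k + 1) := by
    have hk' := Finset.mem_Icc.1 hk
    have hl := hkmin_mem k hk'.1 (by lia)
    have hr := hkmin_mem (k + 1) (by lia) (by lia)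
    have hlr : hkmin k ≤ hkmin (k + 1) := hkmin_mono k.le_succ
    have hint : IntegrableOn (fun t => ∑ j ∈ Finset.range (Smax + 1), g q j t)
        (Set.Ioc hmin hmax) :=
      integrable_finsetSum _ fun j hj => hg_int q hq j (Finset.mem_range_succ_iff.1 hj)
    have hU_add : U q (hkmin k) + ∫ t in Set.Ioc (hkmin k) (hkmin (k + 1)),
        ∑ j ∈ Finset.range (Smax + 1), g q j t = U q (hkmin (k + 1)) := by
      rw [hU q hq _ hl, hU q hq _ hr, ← Set.Ioc_union_Ioc_eq_Ioc hl.1 hlr]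
      exact (setIntegral_union (Set.Ioc_disjoint_Ioc_of_le le_rfl) measurableSet_Ioc
        (hint.mono_set (Set.Ioc_subset_Ioc le_rfl hl.2))
        (hint.mono_set (Set.Ioc_subset_Ioc hl.1 hr.2))).symm
    rw [hHmin k hk, hkmax_eq, hU_add, hVU q hq _ hr]
  have exists_mem (j : ℕ) (hj : y q j x ≠ 0) :
      ∃ k ∈ Finset.Icc 1 M, x ∈ Set.Ioc (Hmin k j q) (Hmin k (j + 1) q) := by
    rw [hy] at hj
    obtain ⟨k, hk, hne⟩ := Finset.exists_ne_zero_of_sum_ne_zero hj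
    refine ⟨k, hk, ?_⟩
    rw [hHminS]
    by_contra h
    simp [h] at hne
  have mem_cell (k : ℕ) (hk : k ∈ Finset.Icc 1 M) (j : ℕ) (hj : j ≤ Smax)
      (hx : x ∈ Set.Ioc (Hmin k j q) (Hmin k (j + 1) q)) :
      x ∈ Set.Ioc (hkmin k) (hkmin (k + 1)) := by
    rw [← hHmin0 k q, ← hHlast k hk]
    exact Set.Ioc_subset_Ioc
      (hHmono k hk (by simp) (Set.mem_Iic.2 (by lia)) j.zero_le)
      (hHmono k hk (Set.mem_Iic.2 (by lia)) (by simp) (by lia)) hx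
  by_cases hys : y q s x = 0
  · simp [hys]
  right
  obtain ⟨k, hk, hxk⟩ := exists_mem s hys
  have hsum : ∑ j ∈ Finset.range (Smax + 1), y q j x = y q s x := by
    refine Finset.sum_eq_single_of_mem s (Finset.mem_range_succ_iff.2 hs) fun j hj hjs => ?_
    by_contra hyj
    rw [Finset.mem_range_succ_iff] at hj
    obtain ⟨l, hl, hxl⟩ := exists_mem j hyj
    obtain rfl : k = l :=
      (hkmin_mono.monotoneOn (Set.Iic (M + 1))).eq_of_mem_Ioc_succ
        (Nat.lt_succ_of_le (Finset.mem_Icc.1 hk).2) (Nat.lt_succ_of_le (Finset.mem_Icc.1 hl).2)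
        (mem_cell k hk s hs hxk) (mem_cell l hl j hj hxl)
    exact hjs ((hHmono k hk).eq_of_mem_Ioc_succ (by lia) (by lia) hxl hxk)
  rw [hsum, div_self hys]
end

section
/- (Lemma 7, upper bound) Let ξ : {0,…,S_max} → ℝ be nonnegative. Define P_M = ∫_{h_min}^{h_max} Σ_{s=0}^{S_max} Σ_{q=0}^{Q} ξ(s) h^{−1} y_M(q,s,h) dh and P_g = ∫_{h_min}^{h_max} Σ_{s=0}^{S_max} Σ_{q=0}^{Q} ξ(s) h^{−1} g(q,s,h) dh. Then P_M ≤ (1 + (h_max − h_min)/(M · h_min)) · P_g. -/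
open MeasureTheory

theorem setIntegral_Ioc_add_Ioc {f : ℝ → ℝ} {a b c : ℝ} (hab : a ≤ b) (hbc : b ≤ c)
    (hf : IntegrableOn f (Set.Ioc a c)) :
    (∫ x in Set.Ioc a b, f x) + ∫ x in Set.Ioc b c, f x = ∫ x in Set.Ioc a c, f x := by
  rw [← Set.Ioc_union_Ioc_eq_Ioc hab hbc, setIntegral_union]
  · exact Set.Ioc_disjoint_Ioc_of_le le_rfl
  · exact measurableSet_Ioc
  · exact hf.mono_set (Set.Ioc_subset_Ioc_right hbc)
  · exact hf.mono_set (Set.Ioc_subset_Ioc_left hab)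

theorem sum_setIntegral_Ioc {f : ℝ → ℝ} {u : ℕ → ℝ} (hu : Monotone u) (n : ℕ)
    (hf : IntegrableOn f (Set.Ioc (u 0) (u n))) :
    ∑ k ∈ Finset.range n, ∫ x in Set.Ioc (u k) (u (k + 1)), f x =
      ∫ x in Set.Ioc (u 0) (u n), f x := by
  induction n with
  | zero => simp
  | succ n ih =>
    rw [Finset.sum_range_succ,
      ih (hf.mono_set (Set.Ioc_subset_Ioc_right (hu n.le_succ))),
      setIntegral_Ioc_add_Ioc (hu n.zero_le) (hu n.le_succ) hf]

theorem integrableOn_inv_mul {f : ℝ → ℝ} {a b : ℝ} (ha : 0 < a)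
    (hf : IntegrableOn f (Set.Ioc a b)) :
    IntegrableOn (fun x => x⁻¹ * f x) (Set.Ioc a b) := by
  refine Integrable.bdd_mul (c := a⁻¹) hf measurable_inv.aestronglyMeasurable ?_
  filter_upwards [ae_restrict_mem measurableSet_Ioc] with x hx
  have hx0 : 0 < x := ha.trans hx.1
  rw [Real.norm_of_nonneg (inv_nonneg.2 hx0.le)]
  exact inv_anti₀ ha hx.1.le

/-- Replacing a density by another one of equal mass inside `(a, b]` changes the integral
against `x⁻¹` by a factor of at most `b / a`. -/
theorem setIntegral_inv_mul_le {f G : ℝ → ℝ} {a b c d : ℝ} (ha : 0 < a) (hac : a ≤ c)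
    (hdb : d ≤ b) (hf : IntegrableOn f (Set.Ioc a b)) (hG : IntegrableOn G (Set.Ioc a b))
    (hf0 : ∀ x, 0 ≤ f x) (hG0 : ∀ x, 0 ≤ G x)
    (h : ∫ x in Set.Ioc c d, G x = ∫ x in Set.Ioc a b, f x) :
    ∫ x in Set.Ioc c d, x⁻¹ * G x ≤ b / a * ∫ x in Set.Ioc a b, x⁻¹ * f x := by
  have hsub : Set.Ioc c d ⊆ Set.Ioc a b := Set.Ioc_subset_Ioc hac hdb
  calc ∫ x in Set.Ioc c d, x⁻¹ * G x ≤ ∫ x in Set.Ioc c d, a⁻¹ * G x := by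
        refine setIntegral_mono_on ((integrableOn_inv_mul ha hG).mono_set hsub)
          ((hG.mono_set hsub).const_mul _) measurableSet_Ioc fun x hx => ?_
        exact mul_le_mul_of_nonneg_right (inv_anti₀ ha (hsub hx).1.le) (hG0 x)
    _ = ∫ x in Set.Ioc a b, a⁻¹ * f x := by
        rw [integral_const_mul, integral_const_mul, h]
    _ ≤ ∫ x in Set.Ioc a b, b / a * (x⁻¹ * f x) := by
        refine setIntegral_mono_on (hf.const_mul _)
          ((integrableOn_inv_mul ha hf).const_mul _) measurableSet_Ioc fun x hx => ?_
        have hx0 : 0 < x := ha.trans hx.1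
        rw [← mul_assoc]
        refine mul_le_mul_of_nonneg_right ?_ (hf0 x)
        rw [div_mul_eq_mul_div, ← div_eq_mul_inv, inv_eq_one_div]
        exact div_le_div_of_nonneg_right ((one_le_div hx0).2 hx.2) ha.le
    _ = b / a * ∫ x in Set.Ioc a b, x⁻¹ * f x := integral_const_mul _ _

/-- Cutting `(α, β]` at the images under the inverse `V` of the cumulative mass `U` gives
consecutive intervals on which the total density has the mass of one single summand. -/
theorem quantile_cut {a b : ℝ} {S : ℕ} {f : ℕ → ℝ → ℝ}
    (hf0 : ∀ s ≤ S, ∀ x, 0 ≤ f s x)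
    (hf : ∀ s ≤ S, IntegrableOn (f s) (Set.Ioc a b)) {U V : ℝ → ℝ}
    (hU : ∀ x ∈ Set.Icc a b,
      U x = ∫ t in Set.Ioc a x, ∑ s ∈ Finset.range (S + 1), f s t)
    (hV : Monotone V) (hVU : ∀ x ∈ Set.Icc a b, V (U x) = x)
    (hUV : ∀ t ∈ Set.Icc 0 (U b), U (V t) = t)
    {α β : ℝ} (haα : a ≤ α) (hαβ : α ≤ β) (hβb : β ≤ b) {T : ℕ → ℝ}
    (hT : ∀ s, T s = V (U α + ∫ t in Set.Ioc α β, ∑ x ∈ Finset.range s, f x t))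
    {s : ℕ} (hs : s ≤ S) :
    α ≤ T s ∧ T s ≤ T (s + 1) ∧ T (s + 1) ≤ β ∧
      ∫ t in Set.Ioc (T s) (T (s + 1)), ∑ j ∈ Finset.range (S + 1), f j t =
        ∫ t in Set.Ioc α β, f s t := by
  have hsub : Set.Ioc α β ⊆ Set.Ioc a b := Set.Ioc_subset_Ioc haα hβb
  have hsum : ∀ n ≤ S + 1,
      IntegrableOn (fun t => ∑ x ∈ Finset.range n, f x t) (Set.Ioc a b) := fun n hn =>
    integrable_finsetSum _ fun i hi => hf i (by have := Finset.mem_range.1 hi; omega)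
  have hG0 : ∀ t, 0 ≤ ∑ x ∈ Finset.range (S + 1), f x t := fun t =>
    Finset.sum_nonneg fun i hi => hf0 i (by have := Finset.mem_range.1 hi; omega) t
  set F : ℕ → ℝ := fun n => ∫ t in Set.Ioc α β, ∑ x ∈ Finset.range n, f x t with hF
  have hFsucc : ∀ n ≤ S, F (n + 1) = F n + ∫ t in Set.Ioc α β, f n t := by
    intro n hn
    simp only [hF, Finset.sum_range_succ]
    exact integral_add ((hsum n (by omega)).mono_set hsub) ((hf n hn).mono_set hsub)
  have hfn : ∀ n ≤ S, 0 ≤ ∫ t in Set.Ioc α β, f n t := fun n hn =>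
    integral_nonneg (hf0 n hn)
  have hFnonneg : ∀ n ≤ S + 1, 0 ≤ F n := fun n hn =>
    integral_nonneg fun t => Finset.sum_nonneg fun i hi =>
      hf0 i (by have := Finset.mem_range.1 hi; omega) t
  have hFle : ∀ n ≤ S + 1, F n ≤ F (S + 1) := fun n hn => by
    refine setIntegral_mono_on ((hsum n hn).mono_set hsub) ((hsum _ le_rfl).mono_set hsub)
      measurableSet_Ioc fun t _ => ?_
    exact Finset.sum_le_sum_of_subset_of_nonneg (Finset.range_mono hn) fun i hi _ =>
      hf0 i (by have := Finset.mem_range.1 hi; omega) t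
  have hα : α ∈ Set.Icc a b := ⟨haα, hαβ.trans hβb⟩
  have hβ : β ∈ Set.Icc a b := ⟨haα.trans hαβ, hβb⟩
  have hUadd : ∀ x y, a ≤ x → x ≤ y → y ≤ b →
      U x + ∫ t in Set.Ioc x y, ∑ s ∈ Finset.range (S + 1), f s t = U y := by
    intro x y hx hxy hy
    rw [hU x ⟨hx, hxy.trans hy⟩, hU y ⟨hx.trans hxy, hy⟩]
    exact setIntegral_Ioc_add_Ioc hx hxy
      ((hsum _ le_rfl).mono_set (Set.Ioc_subset_Ioc_right hy))
  have hUαβ : U α + F (S + 1) = U β := hUadd α β haα hαβ hβb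
  have hUα0 : 0 ≤ U α := by rw [hU α hα]; exact integral_nonneg hG0
  have hUβb : U β ≤ U b := by
    rw [← hUadd β b hβ.1 hβb le_rfl]
    exact le_add_of_nonneg_right (integral_nonneg hG0)
  have hmass : ∀ n ≤ S + 1, U (T n) = U α + F n := fun n hn => by
    rw [hT n]
    exact hUV _ ⟨add_nonneg hUα0 (hFnonneg n hn), by linarith [hFle n hn]⟩
  have hαT : α ≤ T s := by
    rw [hT s]
    exact (hVU α hα).ge.trans (hV (le_add_of_nonneg_right (hFnonneg s (by omega))))
  have hTT : T s ≤ T (s + 1) := by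
    rw [hT, hT]
    refine hV (add_le_add_right ?_ _)
    have := hFsucc s hs
    linarith [hfn s hs]
  have hTβ : T (s + 1) ≤ β := by
    have hle : U α + F (s + 1) ≤ U β := by linarith [hFle (s + 1) (by omega)]
    rw [hT (s + 1)]
    exact (hV hle).trans (hVU β hβ).le
  refine ⟨hαT, hTT, hTβ, ?_⟩
  have h1 := hUadd (T s) (T (s + 1)) (haα.trans hαT) hTT (hTβ.trans hβb)
  rw [hmass s (by omega), hmass (s + 1) (by omega), hFsucc s hs] at h1
  linarith

theorem stmt_14
    (hmin hmax : ℝ) (Q Smax M : ℕ)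
    (h0 : 0 < hmin) (h1 : hmin < hmax) (hM : 0 < M)
    (hkmin hkmax : ℕ → ℝ)
    (hhkmin : ∀ k : ℕ, hkmin k = hmin + ((k : ℝ) - 1) * (hmax - hmin) / M)
    (hhkmax : ∀ k : ℕ, hkmax k = hmin + (k : ℝ) * (hmax - hmin) / M)
    (g : ℕ → ℕ → ℝ → ℝ)
    (hg_nonneg : ∀ q, q ≤ Q → ∀ s, s ≤ Smax → ∀ x : ℝ, 0 ≤ g q s x)
    (hg_meas : ∀ q, q ≤ Q → ∀ s, s ≤ Smax → Measurable (g q s))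
    (hg_int : ∀ q, q ≤ Q → ∀ s, s ≤ Smax → IntegrableOn (g q s) (Set.Ioc hmin hmax))
    (U : ℕ → ℝ → ℝ)
    (hU : ∀ q, q ≤ Q → ∀ x ∈ Set.Icc hmin hmax,
        U q x = ∫ t in Set.Ioc hmin x, ∑ s ∈ Finset.range (Smax + 1), g q s t)
    (V : ℕ → ℝ → ℝ)
    (hV_mono : ∀ q, q ≤ Q → Monotone (V q))
    (hVU : ∀ q, q ≤ Q → ∀ x ∈ Set.Icc hmin hmax, V q (U q x) = x)
    (hUV : ∀ q, q ≤ Q → ∀ t ∈ Set.Icc 0 (U q hmax), U q (V q t) = t)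
    (hVmem : ∀ q, q ≤ Q → ∀ t ∈ Set.Icc 0 (U q hmax), V q t ∈ Set.Icc hmin hmax)
    (Hmax Hmin : ℕ → ℕ → ℕ → ℝ)
    (hHmax : ∀ k s q, Hmax k s q = V q (U q (hkmin k) +
        ∫ t in Set.Ioc (hkmin k) (hkmax k), ∑ x ∈ Finset.range (s + 1), g q x t))
    (hHmin0 : ∀ k q, Hmin k 0 q = hkmin k)
    (hHminS : ∀ k s q, Hmin k (s + 1) q = Hmax k s q)
    (y : ℕ → ℕ → ℝ → ℝ)
    (hy : ∀ q s (x : ℝ), y q s x = ∑ k ∈ Finset.Icc 1 M,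
        (∑ j ∈ Finset.range (Smax + 1), g q j x) *
          (if x ∈ Set.Ioc (Hmin k s q) (Hmax k s q) then (1 : ℝ) else 0))
    (ξ : ℕ → ℝ) (hξ : ∀ s, s ≤ Smax → 0 ≤ ξ s) :
    (∫ x in Set.Ioc hmin hmax,
        ∑ s ∈ Finset.range (Smax + 1), ∑ q ∈ Finset.range (Q + 1),
          ξ s * x⁻¹ * y q s x) ≤
      (1 + (hmax - hmin) / (M * hmin)) *
        ∫ x in Set.Ioc hmin hmax,
          ∑ s ∈ Finset.range (Smax + 1), ∑ q ∈ Finset.range (Q + 1),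
            ξ s * x⁻¹ * g q s x := by
  have hM' : (0 : ℝ) < M := Nat.cast_pos.2 hM
  have hba : 0 < hmax - hmin := sub_pos.2 h1
  set u : ℕ → ℝ := fun k => hmin + (k : ℝ) * (hmax - hmin) / M with hu
  have hu_mono : Monotone u := by
    intro i j hij
    simp only [hu]
    gcongr
  have hu0 : u 0 = hmin := by simp [hu]
  have huM : u M = hmax := by simp only [hu]; field_simp; ring
  have hmin_succ : ∀ k : ℕ, hkmin (k + 1) = u k := fun k => by
    rw [hhkmin]; simp [hu]
  have hmax_succ : ∀ k : ℕ, hkmax (k + 1) = u (k + 1) := fun k => hhkmax _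
  have hmin_le : ∀ k, hmin ≤ u k := fun k => hu0 ▸ hu_mono k.zero_le
  have hle_max : ∀ k, k < M → u (k + 1) ≤ hmax := fun k hk => huM ▸ hu_mono hk
  have hratio : ∀ k, u (k + 1) / u k ≤ 1 + (hmax - hmin) / (M * hmin) := by
    intro k
    have hk : 0 < u k := h0.trans_le (hmin_le k)
    have hstep : u (k + 1) = u k + (hmax - hmin) / M := by
      simp only [hu]; push_cast; ring
    rw [hstep, add_div, div_self hk.ne', div_div]
    have := hmin_le k
    gcongr
  have hG_int : ∀ q ≤ Q, IntegrableOn (fun x => ∑ j ∈ Finset.range (Smax + 1), g q j x)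
      (Set.Ioc hmin hmax) := fun q hq =>
    integrable_finsetSum _ fun j hj =>
      hg_int q hq j (by have := Finset.mem_range.1 hj; omega)
  have hG0 : ∀ q ≤ Q, ∀ x, 0 ≤ ∑ j ∈ Finset.range (Smax + 1), g q j x := fun q hq x =>
    Finset.sum_nonneg fun j hj =>
      hg_nonneg q hq j (by have := Finset.mem_range.1 hj; omega) x
  have hy' : ∀ q s, (fun x : ℝ => x⁻¹ * y q s x) = fun x => ∑ k ∈ Finset.range M,
      (Set.Ioc (Hmin (k + 1) s q) (Hmax (k + 1) s q)).indicator
        (fun x => x⁻¹ * ∑ j ∈ Finset.range (Smax + 1), g q j x) x := by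
    intro q s
    funext x
    rw [hy, Finset.mul_sum, ← Finset.Ico_add_one_right_eq_Icc,
      Finset.sum_Ico_eq_sum_range, Nat.add_sub_cancel]
    refine Finset.sum_congr rfl fun k _ => ?_
    rw [add_comm 1 k, Set.indicator_apply]
    split_ifs <;> simp
  have hy_int : ∀ q ≤ Q, ∀ s, IntegrableOn (fun x => x⁻¹ * y q s x) (Set.Ioc hmin hmax) := by
    intro q hq s
    rw [hy']
    exact integrable_finsetSum _ fun k _ =>
      (integrableOn_inv_mul h0 (hG_int q hq)).indicator measurableSet_Ioc
  have key : ∀ q ≤ Q, ∀ s ≤ Smax, ∫ x in Set.Ioc hmin hmax, x⁻¹ * y q s x ≤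
      (1 + (hmax - hmin) / (M * hmin)) * ∫ x in Set.Ioc hmin hmax, x⁻¹ * g q s x := by
    intro q hq s hs
    have hgq := integrableOn_inv_mul h0 (hg_int q hq s hs)
    rw [hy', integral_finsetSum _ fun k _ =>
      (integrableOn_inv_mul h0 (hG_int q hq)).indicator measurableSet_Ioc]
    have hsplit := sum_setIntegral_Ioc hu_mono M (f := fun x => x⁻¹ * g q s x)
      (by rwa [hu0, huM])
    rw [hu0, huM] at hsplit
    rw [← hsplit, Finset.mul_sum]
    refine Finset.sum_le_sum fun k hk => ?_
    have hkM := Finset.mem_range.1 hk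
    have huk : u k ≤ u (k + 1) := hu_mono k.le_succ
    have hsub : Set.Ioc (u k) (u (k + 1)) ⊆ Set.Ioc hmin hmax :=
      Set.Ioc_subset_Ioc (hmin_le k) (hle_max k hkM)
    have hT : ∀ s, Hmin (k + 1) s q = V q (U q (u k) +
        ∫ t in Set.Ioc (u k) (u (k + 1)), ∑ x ∈ Finset.range s, g q x t) := by
      rintro (_ | s)
      · simp [hHmin0, hmin_succ, hVU q hq _ ⟨hmin_le k, huk.trans (hle_max k hkM)⟩]
      · rw [hHminS, hHmax, hmin_succ, hmax_succ]
    obtain ⟨hl, -, hr, hmass⟩ := quantile_cut (hg_nonneg q hq) (hg_int q hq) (hU q hq)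
      (hV_mono q hq) (hVU q hq) (hUV q hq) (hmin_le k) huk (hle_max k hkM) hT hs
    rw [hHminS] at hr hmass
    have hsub' : Set.Ioc (Hmin (k + 1) s q) (Hmax (k + 1) s q) ⊆ Set.Ioc hmin hmax :=
      (Set.Ioc_subset_Ioc hl hr).trans hsub
    rw [setIntegral_indicator measurableSet_Ioc, Set.inter_eq_self_of_subset_right hsub']
    refine (setIntegral_inv_mul_le (h0.trans_le (hmin_le k)) hl hr
      ((hg_int q hq s hs).mono_set hsub) ((hG_int q hq).mono_set hsub)
      (hg_nonneg q hq s hs) (hG0 q hq) hmass).trans ?_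
    refine mul_le_mul_of_nonneg_right (hratio k)
      (setIntegral_nonneg measurableSet_Ioc fun x hx => ?_)
    exact mul_nonneg (inv_nonneg.2 (h0.trans (hsub hx).1).le) (hg_nonneg q hq s hs x)
  have hint : ∀ w : ℕ → ℕ → ℝ → ℝ, (∀ q ≤ Q, ∀ s ≤ Smax,
      IntegrableOn (fun x => x⁻¹ * w q s x) (Set.Ioc hmin hmax)) →
      (∫ x in Set.Ioc hmin hmax, ∑ s ∈ Finset.range (Smax + 1), ∑ q ∈ Finset.range (Q + 1),
        ξ s * x⁻¹ * w q s x) = ∑ s ∈ Finset.range (Smax + 1), ∑ q ∈ Finset.range (Q + 1),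
          ξ s * ∫ x in Set.Ioc hmin hmax, x⁻¹ * w q s x := by
    intro w hw
    have hw' : ∀ s ∈ Finset.range (Smax + 1), ∀ q ∈ Finset.range (Q + 1),
        IntegrableOn (fun x => ξ s * (x⁻¹ * w q s x)) (Set.Ioc hmin hmax) := fun s hs q hq =>
      (hw q (Finset.mem_range_succ_iff.1 hq) s (Finset.mem_range_succ_iff.1 hs)).const_mul _
    simp only [mul_assoc]
    rw [integral_finsetSum _ fun s hs => integrable_finsetSum _ (hw' s hs)]
    refine Finset.sum_congr rfl fun s hs => ?_
    rw [integral_finsetSum _ (hw' s hs)]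
    exact Finset.sum_congr rfl fun q _ => integral_const_mul _ _
  rw [hint y fun q hq s _ => hy_int q hq s,
    hint g fun q hq s hs => integrableOn_inv_mul h0 (hg_int q hq s hs), Finset.mul_sum]
  refine Finset.sum_le_sum fun s hs => ?_
  rw [Finset.mul_sum]
  refine Finset.sum_le_sum fun q hq => ?_
  have hs' := Finset.mem_range_succ_iff.1 hs
  rw [mul_left_comm]
  exact mul_le_mul_of_nonneg_left (key q (Finset.mem_range_succ_iff.1 hq) s hs') (hξ s hs')
end

section
/- (Theorem 1: feasibility of the constructed solution) Extend g and y_M by setting g(q',s,h) = 0 and y_M(q',s,h) = 0 whenever q' ∉ {0,…,Q}. Let A ≤ S_max be a natural number, α_0,…,α_A real numbers, ā > 0, D_th ≥ 0, and f_H : ℝ → ℝ. Suppose g satisfies: (b) (1/ā)·∫_{h_min}^{h_max} Σ_{s=0}^{S_max} Σ_{q=0}^{Q} q·g(q,s,h) dh ≤ D_th; (c) Σ_{s=0}^{S_max} Σ_{q=0}^{Q} g(q,s,h) = f_H(h) for all h ∈ (h_min,h_max]; (d) Σ_{k=0}^{A} Σ_{s=0}^{S_max} α_k ∫_{h_min}^{h_max}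 g(q+s−k,s,h) dh = Σ_{s=0}^{S_max} ∫_{h_min}^{h_max} g(q,s,h) dh for all q ∈ {0,…,Q}; and (f) for each pair (q,s) with q − s < 0, g(q,s,h) = 0 for all h ∈ (h_min,h_max]. Then y_M satisfies the same four conditions (b), (c), (d), (f), and additionally y_M(q,s,h) ≥ 0 for all q, s, h. -/
open MeasureTheory

/-- The indicators of consecutive half-open intervals add up to the indicator of their union. -/
theorem sum_ite_mem_Ioc_adjacent (a : ℕ → ℝ) (n : ℕ) (ha : ∀ i < n, a i ≤ a (i + 1)) (x : ℝ) :
    a 0 ≤ a n ∧ ∑ i ∈ Finset.range n, (if x ∈ Set.Ioc (a i) (a (i + 1)) then (1 : ℝ) else 0) =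
      if x ∈ Set.Ioc (a 0) (a n) then 1 else 0 := by
  induction n with
  | zero => simp
  | succ n ih =>
    obtain ⟨h0, ih⟩ := ih fun i hi => ha i (hi.trans n.lt_succ_self)
    have h1 := ha n n.lt_succ_self
    refine ⟨h0.trans h1, ?_⟩
    rw [Finset.sum_range_succ, ih]
    simp only [Set.mem_Ioc]
    grind

/-- The integrals over consecutive half-open intervals add up to the integral over their union. -/
theorem sum_setIntegral_Ioc_adjacent {f : ℝ → ℝ} (a : ℕ → ℝ) (n : ℕ)
    (ha : ∀ i < n, a i ≤ a (i + 1)) (hf : IntegrableOn f (Set.Ioc (a 0) (a n))) :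
    ∑ i ∈ Finset.range n, ∫ t in Set.Ioc (a i) (a (i + 1)), f t =
      ∫ t in Set.Ioc (a 0) (a n), f t := by
  induction n with
  | zero => simp
  | succ n ih =>
    have h0 := (sum_ite_mem_Ioc_adjacent a n (fun i hi => ha i (hi.trans n.lt_succ_self)) 0).1
    have h1 := ha n n.lt_succ_self
    rw [← Set.Ioc_union_Ioc_eq_Ioc h0 h1] at hf ⊢
    rw [Finset.sum_range_succ, ih (fun i hi => ha i (hi.trans n.lt_succ_self)) hf.left_of_union,
      setIntegral_union (Set.Ioc_disjoint_Ioc_of_le le_rfl) measurableSet_Ioc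
        hf.left_of_union hf.right_of_union]

theorem mul_ite_mem_Ioc_eq_indicator (f : ℝ → ℝ) (c d : ℝ) :
    (fun t => f t * (if t ∈ Set.Ioc c d then (1 : ℝ) else 0)) = (Set.Ioc c d).indicator f := by
  ext t
  by_cases ht : t ∈ Set.Ioc c d
  · rw [if_pos ht, Set.indicator_of_mem ht, mul_one]
  · rw [if_neg ht, Set.indicator_of_notMem ht, mul_zero]

/-- Nonnegative integrable layers `g 0, …, g (N - 1)` on `(l, r]`, with the primitive `U` of their
sum and a monotone inverse `V` of `U`. -/
structure IsLayering (l r : ℝ) (N : ℕ) (g : ℕ → ℝ → ℝ) (U V : ℝ → ℝ) : Prop where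
  nonneg : ∀ s < N, ∀ x, 0 ≤ g s x
  integrable : ∀ s < N, IntegrableOn (g s) (Set.Ioc l r)
  primitive : ∀ x ∈ Set.Icc l r, U x = ∫ t in Set.Ioc l x, ∑ s ∈ Finset.range N, g s t
  mono : Monotone V
  left_inv : ∀ x ∈ Set.Icc l r, V (U x) = x
  right_inv : ∀ t ∈ Set.Icc 0 (U r), U (V t) = t
  mem : ∀ t ∈ Set.Icc 0 (U r), V t ∈ Set.Icc l r

/-- The level of `U` reached from `a` after adding the mass in `(a, b]` of the first `s` layers. -/
noncomputable def layerLevel (g : ℕ → ℝ → ℝ) (U : ℝ → ℝ) (a b : ℝ) (s : ℕ) : ℝ :=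
  U a + ∫ t in Set.Ioc a b, ∑ x ∈ Finset.range s, g x t

namespace IsLayering

variable {l r : ℝ} {N : ℕ} {g : ℕ → ℝ → ℝ} {U V : ℝ → ℝ}

theorem integrableOn_sum (h : IsLayering l r N g U V) {s : ℕ} (hs : s ≤ N) {a b : ℝ}
    (ha : l ≤ a) (hb : b ≤ r) :
    IntegrableOn (fun t => ∑ x ∈ Finset.range s, g x t) (Set.Ioc a b) :=
  integrable_finsetSum _ fun x hx =>
    (h.integrable x ((Finset.mem_range.1 hx).trans_le hs)).mono_set (Set.Ioc_subset_Ioc ha hb)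

theorem setIntegral_Ioc_eq_sub (h : IsLayering l r N g U V) {a b : ℝ} (ha : l ≤ a) (hab : a ≤ b)
    (hb : b ≤ r) : ∫ t in Set.Ioc a b, ∑ s ∈ Finset.range N, g s t = U b - U a := by
  rw [h.primitive a ⟨ha, hab.trans hb⟩, h.primitive b ⟨ha.trans hab, hb⟩,
    ← Set.Ioc_union_Ioc_eq_Ioc ha hab,
    setIntegral_union (Set.Ioc_disjoint_Ioc_of_le le_rfl) measurableSet_Ioc
      (h.integrableOn_sum le_rfl le_rfl (hab.trans hb)) (h.integrableOn_sum le_rfl ha hb)]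
  ring

theorem layerLevel_succ (h : IsLayering l r N g U V) {a b : ℝ} (ha : l ≤ a) (hb : b ≤ r)
    {s : ℕ} (hs : s < N) :
    layerLevel g U a b (s + 1) = layerLevel g U a b s + ∫ t in Set.Ioc a b, g s t := by
  simp only [layerLevel, Finset.sum_range_succ]
  rw [integral_add (h.integrableOn_sum hs.le ha hb)
    ((h.integrable s hs).mono_set (Set.Ioc_subset_Ioc ha hb)), add_assoc]

theorem layerLevel_le_succ (h : IsLayering l r N g U V) {a b : ℝ} (ha : l ≤ a) (hb : b ≤ r)
    {s : ℕ} (hs : s < N) : layerLevel g U a b s ≤ layerLevel g U a b (s + 1) := by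
  rw [h.layerLevel_succ ha hb hs]
  exact le_add_of_nonneg_right (integral_nonneg (h.nonneg s hs))

theorem layerLevel_zero (g : ℕ → ℝ → ℝ) (U : ℝ → ℝ) (a b : ℝ) : layerLevel g U a b 0 = U a := by
  simp [layerLevel]

theorem layerLevel_last (h : IsLayering l r N g U V) {a b : ℝ} (ha : l ≤ a) (hab : a ≤ b)
    (hb : b ≤ r) : layerLevel g U a b N = U b := by
  rw [layerLevel, h.setIntegral_Ioc_eq_sub ha hab hb]
  ring

theorem primitive_mono (h : IsLayering l r N g U V) {a b : ℝ} (ha : l ≤ a) (hab : a ≤ b)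
    (hb : b ≤ r) : U a ≤ U b := by
  rw [← sub_nonneg, ← h.setIntegral_Ioc_eq_sub ha hab hb]
  exact integral_nonneg fun t =>
    Finset.sum_nonneg fun s hs => h.nonneg s (Finset.mem_range.1 hs) t

theorem layerLevel_mem (h : IsLayering l r N g U V) {a b : ℝ} (ha : l ≤ a) (hab : a ≤ b)
    (hb : b ≤ r) {s : ℕ} (hs : s ≤ N) : layerLevel g U a b s ∈ Set.Icc 0 (U r) := by
  have nn : ∀ n ≤ N, ∀ t, 0 ≤ ∑ x ∈ Finset.range n, g x t := fun n hn t =>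
    Finset.sum_nonneg fun x hx => h.nonneg x ((Finset.mem_range.1 hx).trans_le hn) t
  have hl : U l = 0 := by simp [h.primitive l ⟨le_rfl, (ha.trans hab).trans hb⟩]
  constructor
  · have := h.primitive_mono le_rfl ha (hab.trans hb)
    exact add_nonneg (hl ▸ this) (integral_nonneg (nn s hs))
  · refine le_trans ?_ (h.primitive_mono (ha.trans hab) hb le_rfl)
    rw [← h.layerLevel_last ha hab hb]
    refine add_le_add le_rfl (integral_mono (h.integrableOn_sum hs ha hb)
      (h.integrableOn_sum le_rfl ha hb) fun t => ?_)
    exact Finset.sum_le_sum_of_subset_of_nonneg (by simpa using hs) fun x hx _ =>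
      h.nonneg x (Finset.mem_range.1 hx) t

theorem cut_le_succ (h : IsLayering l r N g U V) {a b : ℝ} (ha : l ≤ a) (hb : b ≤ r)
    {s : ℕ} (hs : s < N) : V (layerLevel g U a b s) ≤ V (layerLevel g U a b (s + 1)) :=
  h.mono (h.layerLevel_le_succ ha hb hs)

theorem sum_cut_indicator (h : IsLayering l r N g U V) {a b : ℝ} (ha : l ≤ a) (hab : a ≤ b)
    (hb : b ≤ r) (x : ℝ) :
    ∑ s ∈ Finset.range N, (if x ∈ Set.Ioc (V (layerLevel g U a b s))
      (V (layerLevel g U a b (s + 1))) then (1 : ℝ) else 0) =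
      if x ∈ Set.Ioc a b then 1 else 0 := by
  rw [(sum_ite_mem_Ioc_adjacent (fun s => V (layerLevel g U a b s)) N
      (fun s hs => h.cut_le_succ ha hb hs) x).2,
    layerLevel_zero, h.layerLevel_last ha hab hb, h.left_inv a ⟨ha, hab.trans hb⟩,
    h.left_inv b ⟨ha.trans hab, hb⟩]

/-- Between consecutive cuts, the total density has the mass of a single layer on `(a, b]`. -/
theorem setIntegral_cut (h : IsLayering l r N g U V) {a b : ℝ} (ha : l ≤ a) (hab : a ≤ b)
    (hb : b ≤ r) {s : ℕ} (hs : s < N) :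
    ∫ t in Set.Ioc l r, (∑ j ∈ Finset.range N, g j t) *
      (if t ∈ Set.Ioc (V (layerLevel g U a b s)) (V (layerLevel g U a b (s + 1)))
        then (1 : ℝ) else 0) = ∫ t in Set.Ioc a b, g s t := by
  have m0 := h.layerLevel_mem ha hab hb hs.le
  have m1 := h.layerLevel_mem ha hab hb (Nat.succ_le_of_lt hs)
  have v0 := h.mem _ m0
  have v1 := h.mem _ m1
  rw [mul_ite_mem_Ioc_eq_indicator, setIntegral_indicator measurableSet_Ioc,
    Set.inter_eq_self_of_subset_right (Set.Ioc_subset_Ioc v0.1 v1.2),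
    h.setIntegral_Ioc_eq_sub v0.1 (h.cut_le_succ ha hb hs) v1.2, h.right_inv _ m0,
    h.right_inv _ m1, h.layerLevel_succ ha hb hs]
  ring

theorem integrableOn_cut (h : IsLayering l r N g U V) (c d : ℝ) :
    IntegrableOn (fun t => (∑ j ∈ Finset.range N, g j t) *
      (if t ∈ Set.Ioc c d then (1 : ℝ) else 0)) (Set.Ioc l r) := by
  rw [mul_ite_mem_Ioc_eq_indicator]
  exact (h.integrableOn_sum le_rfl le_rfl le_rfl).indicator measurableSet_Ioc

variable {p : ℕ → ℝ} {M : ℕ} {z : ℕ → ℝ → ℝ}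

theorem mesh_bounds (hp : Monotone p) (hp0 : p 0 = l) (hpM : p M = r) {k : ℕ} (hk : k < M) :
    l ≤ p k ∧ p k ≤ p (k + 1) ∧ p (k + 1) ≤ r :=
  ⟨hp0 ▸ hp (Nat.zero_le k), hp k.le_succ, hpM ▸ hp (Nat.succ_le_of_lt hk)⟩

/-- Rearranging the layers within each mesh cell preserves their pointwise total. -/
theorem sum_rearranged (h : IsLayering l r N g U V) (hp : Monotone p) (hp0 : p 0 = l)
    (hpM : p M = r)
    (hz : ∀ s x, z s x = ∑ k ∈ Finset.range M, (∑ j ∈ Finset.range N, g j x) *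
      (if x ∈ Set.Ioc (V (layerLevel g U (p k) (p (k + 1)) s))
        (V (layerLevel g U (p k) (p (k + 1)) (s + 1))) then (1 : ℝ) else 0))
    {x : ℝ} (hx : x ∈ Set.Ioc l r) :
    ∑ s ∈ Finset.range N, z s x = ∑ s ∈ Finset.range N, g s x := by
  simp only [hz]
  rw [Finset.sum_comm]
  simp only [← Finset.mul_sum]
  have hcell : ∀ k ∈ Finset.range M, ∑ s ∈ Finset.range N,
      (if x ∈ Set.Ioc (V (layerLevel g U (p k) (p (k + 1)) s))
        (V (layerLevel g U (p k) (p (k + 1)) (s + 1))) then (1 : ℝ) else 0) =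
      if x ∈ Set.Ioc (p k) (p (k + 1)) then 1 else 0 := fun k hk => by
    obtain ⟨h1, h2, h3⟩ := mesh_bounds hp hp0 hpM (Finset.mem_range.1 hk)
    exact h.sum_cut_indicator h1 h2 h3 x
  rw [Finset.sum_congr rfl hcell,
    (sum_ite_mem_Ioc_adjacent p M (fun k _ => hp k.le_succ) x).2, hp0, hpM, if_pos hx, mul_one]

/-- Rearranging the layers within each mesh cell preserves the mass of every layer. -/
theorem setIntegral_rearranged (h : IsLayering l r N g U V) (hp : Monotone p) (hp0 : p 0 = l)
    (hpM : p M = r)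
    (hz : ∀ s x, z s x = ∑ k ∈ Finset.range M, (∑ j ∈ Finset.range N, g j x) *
      (if x ∈ Set.Ioc (V (layerLevel g U (p k) (p (k + 1)) s))
        (V (layerLevel g U (p k) (p (k + 1)) (s + 1))) then (1 : ℝ) else 0))
    {s : ℕ} (hs : s < N) :
    ∫ x in Set.Ioc l r, z s x = ∫ x in Set.Ioc l r, g s x := by
  simp only [hz]
  rw [integral_finsetSum _ fun k _ => h.integrableOn_cut _ _, ← hp0, ← hpM,
    ← sum_setIntegral_Ioc_adjacent p M (fun k _ => hp k.le_succ)
      (by rw [hp0, hpM]; exact h.integrable s hs), hp0, hpM]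
  refine Finset.sum_congr rfl fun k hk => ?_
  obtain ⟨h1, h2, h3⟩ := mesh_bounds hp hp0 hpM (Finset.mem_range.1 hk)
  exact h.setIntegral_cut h1 h2 h3 hs

/-- A layer that vanishes on `(l, r]` is still zero after rearranging. -/
theorem rearranged_eq_zero (h : IsLayering l r N g U V) (hp : Monotone p) (hp0 : p 0 = l)
    (hpM : p M = r)
    (hz : ∀ s x, z s x = ∑ k ∈ Finset.range M, (∑ j ∈ Finset.range N, g j x) *
      (if x ∈ Set.Ioc (V (layerLevel g U (p k) (p (k + 1)) s))
        (V (layerLevel g U (p k) (p (k + 1)) (s + 1))) then (1 : ℝ) else 0))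
    {s : ℕ} (hs : s < N) (hg : ∀ x ∈ Set.Ioc l r, g s x = 0) (x : ℝ) : z s x = 0 := by
  rw [hz]
  refine Finset.sum_eq_zero fun k hk => ?_
  obtain ⟨h1, h2, h3⟩ := mesh_bounds hp hp0 hpM (Finset.mem_range.1 hk)
  rw [h.layerLevel_succ h1 h3 hs, setIntegral_eq_zero_of_forall_eq_zero
    fun t ht => hg t (Set.Ioc_subset_Ioc h1 h3 ht)]
  simp

end IsLayering

theorem stmt_16
    (hmin hmax : ℝ) (Q Smax M : ℕ)
    (h0 : 0 < hmin) (h1 : hmin < hmax) (hM : 0 < M)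
    (hkmin hkmax : ℕ → ℝ)
    (hhkmin : ∀ k : ℕ, hkmin k = hmin + ((k : ℝ) - 1) * (hmax - hmin) / M)
    (hhkmax : ∀ k : ℕ, hkmax k = hmin + (k : ℝ) * (hmax - hmin) / M)
    (g : ℤ → ℕ → ℝ → ℝ)
    (hg_nonneg : ∀ q : ℤ, 0 ≤ q → q ≤ Q → ∀ s, s ≤ Smax → ∀ x : ℝ, 0 ≤ g q s x)
    (hg_meas : ∀ q : ℤ, 0 ≤ q → q ≤ Q → ∀ s, s ≤ Smax → Measurable (g q s))
    (hg_int : ∀ q : ℤ, 0 ≤ q → q ≤ Q → ∀ s, s ≤ Smax →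
        IntegrableOn (g q s) (Set.Ioc hmin hmax))
    (hg_ext : ∀ q : ℤ, (q < 0 ∨ (Q : ℤ) < q) → ∀ (s : ℕ) (x : ℝ), g q s x = 0)
    (U : ℤ → ℝ → ℝ)
    (hU : ∀ q : ℤ, 0 ≤ q → q ≤ Q → ∀ x ∈ Set.Icc hmin hmax,
        U q x = ∫ t in Set.Ioc hmin x, ∑ s ∈ Finset.range (Smax + 1), g q s t)
    (V : ℤ → ℝ → ℝ)
    (hV_mono : ∀ q : ℤ, 0 ≤ q → q ≤ Q → Monotone (V q))
    (hVU : ∀ q : ℤ, 0 ≤ q → q ≤ Q → ∀ x ∈ Set.Icc hmin hmax, V q (U q x) = x)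
    (hUV : ∀ q : ℤ, 0 ≤ q → q ≤ Q → ∀ t ∈ Set.Icc 0 (U q hmax), U q (V q t) = t)
    (hVmem : ∀ q : ℤ, 0 ≤ q → q ≤ Q → ∀ t ∈ Set.Icc 0 (U q hmax),
        V q t ∈ Set.Icc hmin hmax)
    (Hmax Hmin : ℕ → ℕ → ℤ → ℝ)
    (hHmax : ∀ (k s : ℕ) (q : ℤ), Hmax k s q = V q (U q (hkmin k) +
        ∫ t in Set.Ioc (hkmin k) (hkmax k), ∑ x ∈ Finset.range (s + 1), g q x t))
    (hHmin0 : ∀ (k : ℕ) (q : ℤ), Hmin k 0 q = hkmin k)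
    (hHminS : ∀ (k s : ℕ) (q : ℤ), Hmin k (s + 1) q = Hmax k s q)
    (y : ℤ → ℕ → ℝ → ℝ)
    (hy : ∀ q : ℤ, 0 ≤ q → q ≤ Q → ∀ (s : ℕ) (x : ℝ),
        y q s x = ∑ k ∈ Finset.Icc 1 M,
          (∑ j ∈ Finset.range (Smax + 1), g q j x) *
            (if x ∈ Set.Ioc (Hmin k s q) (Hmax k s q) then (1 : ℝ) else 0))
    (hy_ext : ∀ q : ℤ, (q < 0 ∨ (Q : ℤ) < q) → ∀ (s : ℕ) (x : ℝ), y q s x = 0)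
    (A : ℕ) (hA : A ≤ Smax) (α : ℕ → ℝ)
    (abar Dth : ℝ) (habar : 0 < abar) (hDth : 0 ≤ Dth) (fH : ℝ → ℝ)
    (hb : (1 / abar) * ∫ x in Set.Ioc hmin hmax,
        ∑ s ∈ Finset.range (Smax + 1), ∑ q ∈ Finset.Icc (0 : ℤ) (Q : ℤ),
          (q : ℝ) * g q s x ≤ Dth)
    (hc : ∀ x ∈ Set.Ioc hmin hmax,
        ∑ s ∈ Finset.range (Smax + 1), ∑ q ∈ Finset.Icc (0 : ℤ) (Q : ℤ),
          g q s x = fH x)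
    (hd : ∀ q : ℤ, 0 ≤ q → q ≤ Q →
        ∑ k ∈ Finset.range (A + 1), ∑ s ∈ Finset.range (Smax + 1),
          α k * ∫ x in Set.Ioc hmin hmax, g (q + s - k) s x =
        ∑ s ∈ Finset.range (Smax + 1), ∫ x in Set.Ioc hmin hmax, g q s x)
    (hf : ∀ q : ℤ, 0 ≤ q → q ≤ Q → ∀ s : ℕ, s ≤ Smax → q - s < 0 →
        ∀ x ∈ Set.Ioc hmin hmax, g q s x = 0) :
    ((1 / abar) * ∫ x in Set.Ioc hmin hmax,
        ∑ s ∈ Finset.range (Smax + 1), ∑ q ∈ Finset.Icc (0 : ℤ) (Q : ℤ),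
          (q : ℝ) * y q s x ≤ Dth) ∧
    (∀ x ∈ Set.Ioc hmin hmax,
        ∑ s ∈ Finset.range (Smax + 1), ∑ q ∈ Finset.Icc (0 : ℤ) (Q : ℤ),
          y q s x = fH x) ∧
    (∀ q : ℤ, 0 ≤ q → q ≤ Q →
        ∑ k ∈ Finset.range (A + 1), ∑ s ∈ Finset.range (Smax + 1),
          α k * ∫ x in Set.Ioc hmin hmax, y (q + s - k) s x =
        ∑ s ∈ Finset.range (Smax + 1), ∫ x in Set.Ioc hmin hmax, y q s x) ∧
    (∀ q : ℤ, 0 ≤ q → q ≤ Q → ∀ s : ℕ, s ≤ Smax → q - s < 0 →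
        ∀ x ∈ Set.Ioc hmin hmax, y q s x = 0) ∧
    (∀ (q : ℤ) (s : ℕ) (x : ℝ), 0 ≤ y q s x) := by
  let p : ℕ → ℝ := fun k => hmin + (k : ℝ) * (hmax - hmin) / M
  have hM' : (0 : ℝ) < M := by exact_mod_cast hM
  have hp : Monotone p := by
    intro i j hij
    have : (i : ℝ) ≤ j := by exact_mod_cast hij
    have := sub_pos.2 h1
    simp only [p]
    gcongr
  have hp0 : p 0 = hmin := by simp [p]
  have hpM : p M = hmax := by
    simp only [p]
    field_simp
    ring
  have hmin_succ : ∀ k, hkmin (k + 1) = p k := by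
    intro k
    rw [hhkmin]
    push_cast
    simp [p]
  have hL : ∀ q : ℤ, 0 ≤ q → q ≤ Q → IsLayering hmin hmax (Smax + 1) (g q) (U q) (V q) :=
    fun q hq hQ =>
      { nonneg := fun s hs => hg_nonneg q hq hQ s (Nat.le_of_lt_succ hs)
        integrable := fun s hs => hg_int q hq hQ s (Nat.le_of_lt_succ hs)
        primitive := hU q hq hQ
        mono := hV_mono q hq hQ
        left_inv := hVU q hq hQ
        right_inv := hUV q hq hQ
        mem := hVmem q hq hQ }
  have hmax_cut : ∀ k s q, Hmax (k + 1) s q =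
      V q (layerLevel (g q) (U q) (p k) (p (k + 1)) (s + 1)) := by
    intro k s q
    rw [hHmax, hmin_succ, hhkmax, layerLevel]
  have hz : ∀ q : ℤ, 0 ≤ q → q ≤ Q → ∀ s x, y q s x =
      ∑ k ∈ Finset.range M, (∑ j ∈ Finset.range (Smax + 1), g q j x) *
        (if x ∈ Set.Ioc (V q (layerLevel (g q) (U q) (p k) (p (k + 1)) s))
          (V q (layerLevel (g q) (U q) (p k) (p (k + 1)) (s + 1))) then (1 : ℝ) else 0) := by
    intro q hq hQ s x
    rw [hy q hq hQ, ← Finset.Ico_add_one_right_eq_Icc, Finset.sum_Ico_eq_sum_range,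
      Nat.add_sub_cancel]
    refine Finset.sum_congr rfl fun k hk => ?_
    obtain ⟨b1, b2, b3⟩ := IsLayering.mesh_bounds hp hp0 hpM (Finset.mem_range.1 hk)
    have hmin_cut : Hmin (k + 1) s q = V q (layerLevel (g q) (U q) (p k) (p (k + 1)) s) := by
      cases s with
      | zero =>
        rw [hHmin0, hmin_succ, IsLayering.layerLevel_zero, hVU q hq hQ _ ⟨b1, b2.trans b3⟩]
      | succ s => rw [hHminS, hmax_cut]
    rw [add_comm 1 k, hmin_cut, hmax_cut]
  have hsum : ∀ q : ℤ, 0 ≤ q → q ≤ Q → ∀ x ∈ Set.Ioc hmin hmax,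
      ∑ s ∈ Finset.range (Smax + 1), y q s x = ∑ s ∈ Finset.range (Smax + 1), g q s x :=
    fun q hq hQ x hx => (hL q hq hQ).sum_rearranged hp hp0 hpM (hz q hq hQ) hx
  have hint : ∀ (q : ℤ) (s : ℕ), s ∈ Finset.range (Smax + 1) →
      ∫ x in Set.Ioc hmin hmax, y q s x = ∫ x in Set.Ioc hmin hmax, g q s x := by
    intro q s hs
    by_cases hq : 0 ≤ q ∧ q ≤ Q
    · exact (hL q hq.1 hq.2).setIntegral_rearranged hp hp0 hpM (hz q hq.1 hq.2)
        (Finset.mem_range.1 hs)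
    · have hq' : q < 0 ∨ (Q : ℤ) < q := by omega
      simp only [hy_ext q hq', hg_ext q hq']
  refine ⟨?_, fun x hx => ?_, fun q hq hQ => ?_, fun q hq hQ s hs hqs x _ => ?_, fun q s x => ?_⟩
  · rw [setIntegral_congr_fun (g := fun x => ∑ s ∈ Finset.range (Smax + 1),
      ∑ q ∈ Finset.Icc (0 : ℤ) (Q : ℤ), (q : ℝ) * g q s x) measurableSet_Ioc fun x hx => ?_]
    · exact hb
    · dsimp only
      rw [Finset.sum_comm, Finset.sum_comm (s := Finset.range (Smax + 1))]
      refine Finset.sum_congr rfl fun q hq => ?_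
      rw [← Finset.mul_sum, ← Finset.mul_sum,
        hsum q (Finset.mem_Icc.1 hq).1 (Finset.mem_Icc.1 hq).2 x hx]
  · rw [← hc x hx, Finset.sum_comm, Finset.sum_comm (s := Finset.range (Smax + 1))]
    exact Finset.sum_congr rfl fun q hq =>
      hsum q (Finset.mem_Icc.1 hq).1 (Finset.mem_Icc.1 hq).2 x hx
  · rw [Finset.sum_congr rfl (hint q), ← hd q hq hQ]
    exact Finset.sum_congr rfl fun k _ => Finset.sum_congr rfl fun s hs => by rw [hint _ s hs]
  · exact (hL q hq hQ).rearranged_eq_zero hp hp0 hpM (hz q hq hQ) (Nat.lt_succ_of_le hs)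
      (hf q hq hQ s hs hqs) x
  · by_cases hq : 0 ≤ q ∧ q ≤ Q
    · rw [hy q hq.1 hq.2]
      refine Finset.sum_nonneg fun k _ => mul_nonneg (Finset.sum_nonneg fun j hj => ?_) ?_
      · exact hg_nonneg q hq.1 hq.2 j (Nat.le_of_lt_succ (Finset.mem_range.1 hj)) x
      · split_ifs <;> norm_num
    · exact (hy_ext q (by omega) s x).ge
end
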